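/- If a quasi-simplicial map p: K → L between polyhedra is surjective and n-regular, then p is a weak n-homotopy equivalence. -/

import Mathlib

open Set Metric unitInterval
open scoped ENNReal Classical

noncomputable section

/-! ### Basic extension-theoretic notions -/

/-- A topological space has covering dimension `< n` (order of refinements at most `n`):
every open cover admits an open refinement in which every point belongs to
at most `n` members. -/
def CovDimLT (X : Type*) [TopologicalSpace X] (n : ℕ) : Prop :=
  ∀ U : Set (Set X), (∀ u ∈ U, IsOpen u) → ⋃₀ U = univ →
    ∃ R : Set (Set X), (∀ r ∈ R, IsOpen r) ∧ ⋃₀ R = univ ∧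
      (∀ r ∈ R, ∃ u ∈ U, r ⊆ u) ∧
      ∀ x : X, {r ∈ R | x ∈ r}.Finite ∧ {r ∈ R | x ∈ r}.ncard ≤ n

/-- Lebesgue covering dimension at most `n`. -/
def CovDimLE (X : Type*) [TopologicalSpace X] (n : ℕ) : Prop :=
  CovDimLT X (n + 1)

/-- `X` is an absolute extensor in dimension `n` (an `AE(n)`): every continuous map into `X`
from a closed subset of an at most `n`-dimensional metric space `Y` extends continuously
over all of `Y`. -/
def IsAE.{u, v} (n : ℕ) (X : Type v) [TopologicalSpace X] : Prop :=
  ∀ (Y : Type u) [MetricSpace Y], CovDimLE Y n →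
    ∀ A : Set Y, IsClosed A → ∀ f : C(A, X),
      ∃ g : C(Y, X), ∀ a : A, g ↑a = f a

/-- `X` is an absolute neighborhood extensor in dimension `n` (an `ANE(n)`): every continuous
map into `X` from a closed subset `A` of an at most `n`-dimensional metric space extends
continuously over some open neighborhood of `A`. -/
def IsANE.{u, v} (n : ℕ) (X : Type v) [TopologicalSpace X] : Prop :=
  ∀ (Y : Type u) [MetricSpace Y], CovDimLE Y n →
    ∀ A : Set Y, IsClosed A → ∀ f : C(A, X),
      ∃ (U : Set Y) (_ : IsOpen U) (hAU : A ⊆ U) (g : C(U, X)),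
        ∀ (a : Y) (ha : a ∈ A), g ⟨a, hAU ha⟩ = f ⟨a, ha⟩

/-- `X` is an `ANE(∞)`: an absolute neighborhood extensor for the class of all metric
spaces (no dimension restriction). -/
def IsANEInf.{u, v} (X : Type v) [TopologicalSpace X] : Prop :=
  ∀ (Y : Type u) [MetricSpace Y],
    ∀ A : Set Y, IsClosed A → ∀ f : C(A, X),
      ∃ (U : Set Y) (_ : IsOpen U) (hAU : A ⊆ U) (g : C(U, X)),
        ∀ (a : Y) (ha : a ∈ A), g ⟨a, hAU ha⟩ = f ⟨a, ha⟩

/-! ### Covers -/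

/-- An (indexed) family is a cover when its union is everything. -/
def IsCover {ι X : Type*} (F : ι → Set X) : Prop :=
  (⋃ i, F i) = univ

/-- A cover is an `AE(n)`-cover if the intersection of every (nonempty) subfamily is either
empty or an absolute extensor in dimension `n`. -/
def IsAECover.{u, v, w} (n : ℕ) {ι : Type v} {X : Type w} [TopologicalSpace X]
    (F : ι → Set X) : Prop :=
  IsCover F ∧ ∀ A : Set ι, A.Nonempty →
    (⋂ i ∈ A, F i) = ∅ ∨ IsAE.{u} n (⋂ i ∈ A, F i)

/-- Two covers with the same indexing set are isomorphic if corresponding subfamilies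
have nonempty intersections simultaneously. -/
def CoversIsomorphic {ι X Y : Type*} (F : ι → Set X) (G : ι → Set Y) : Prop :=
  ∀ J : Set ι, (⋂ i ∈ J, F i).Nonempty ↔ (⋂ i ∈ J, G i).Nonempty

/-- A cover is locally finite-dimensional if its nerve is a locally finite-dimensional
simplicial complex: every vertex belongs to simplices of bounded dimension only. -/
def LocallyFinDimCover {ι X : Type*} (F : ι → Set X) : Prop :=
  ∀ i : ι, ∃ N : ℕ, ∀ A : Finset ι, i ∈ A → (⋂ j ∈ A, F j).Nonempty → A.card ≤ N

/-- Two maps are `F`-close when each pair of corresponding values lies in a common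
element of `F`. -/
def CoverClose {ι X Y : Type*} (F : ι → Set Y) (f g : X → Y) : Prop :=
  ∀ x : X, ∃ i : ι, f x ∈ F i ∧ g x ∈ F i

/-- Two maps are `F`-homotopic when they are joined by a homotopy each of whose paths
lies in a single element of `F`. -/
def CoverHomotopic {ι X Y : Type*} [TopologicalSpace X] [TopologicalSpace Y]
    (F : ι → Set Y) (f g : C(X, Y)) : Prop :=
  ∃ H : f.Homotopy g, ∀ x : X, ∃ i : ι, ∀ t : unitInterval, H (t, x) ∈ F i

/-- The mesh of a cover: the supremum of the diameters of its elements. -/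
def coverMesh {ι X : Type*} [PseudoEMetricSpace X] (F : ι → Set X) : ℝ≥0∞ :=
  ⨆ i, EMetric.diam (F i)

/-! ### Homotopy-theoretic notions -/

/-- The function induced by a continuous map on homotopy groups (of index type `N`). -/
def HomotopyGroup.inducedMap {X Y : Type*} [TopologicalSpace X] [TopologicalSpace Y]
    (f : C(X, Y)) (N : Type*) (x : X) :
    HomotopyGroup N X x → HomotopyGroup N Y (f x) :=
  Quotient.map
    (fun g => ⟨f.comp g.1, fun y hy => by
      simp only [ContinuousMap.comp_apply]
      rw [g.2 y hy]⟩)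
    (fun g h H => H.elim fun H => ⟨H.compContinuousMap f⟩)

/-- A continuous map is a weak `n`-homotopy equivalence if it induces isomorphisms on
homotopy groups in all dimensions `< n`, regardless of the choice of basepoint. -/
def IsWeakNHomotopyEquiv {X Y : Type*} [TopologicalSpace X] [TopologicalSpace Y]
    (n : ℕ) (f : C(X, Y)) : Prop :=
  ∀ k < n, ∀ x : X, Function.Bijective (HomotopyGroup.inducedMap f (Fin k) x)

/-- `X` has vanishing homotopy groups in all dimensions `< n`, for every basepoint. -/
def VanishingHomotopyBelow (n : ℕ) (X : Type*) [TopologicalSpace X] : Prop :=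
  ∀ k < n, ∀ x : X, Subsingleton (HomotopyGroup (Fin k) X x)

/-- `f` is null-homotopic inside the subset `U`: there is a homotopy, with values in `U`,
from `f` to a constant map. -/
def NullHomotopicIn {S X : Type*} [TopologicalSpace S] [TopologicalSpace X]
    (f : C(S, X)) (U : Set X) : Prop :=
  ∃ (H : C(S × unitInterval, X)) (c : X),
    (∀ s : S, H (s, 0) = f s) ∧ (∀ s : S, H (s, 1) = c) ∧ ∀ z, H z ∈ U

/-- `X` is locally `k`-connected: every neighborhood `U` of a point contains a
neighborhood `V` of the point such that every map of the `k`-sphere into `V` is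
null-homotopic in `U`. -/
def LocallyKConnected (k : ℕ) (X : Type*) [TopologicalSpace X] : Prop :=
  ∀ (x : X) (U : Set X), IsOpen U → x ∈ U →
    ∃ V : Set X, IsOpen V ∧ x ∈ V ∧
      ∀ f : C(Metric.sphere (0 : EuclideanSpace ℝ (Fin (k + 1))) 1, X),
        (∀ s, f s ∈ V) → NullHomotopicIn f U

/-- `A` is a deformation retract of `B` (both subsets of an ambient space `X`). -/
def IsDeformationRetractOf {X : Type*} [TopologicalSpace X] (A B : Set X) : Prop :=
  A ⊆ B ∧ ∃ H : C(B × unitInterval, X),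
    (∀ b : B, H (b, 0) = ↑b) ∧ (∀ b : B, H (b, 1) ∈ A) ∧
    (∀ (b : B) (t : unitInterval), H (b, t) ∈ B) ∧
    ∀ b : B, (b : X) ∈ A → H (b, 1) = ↑b

/-! ### Simplicial complexes and their metric realizations -/

/-- An abstract simplicial complex on a vertex type `V`. -/
structure SComplex (V : Type*) where
  faces : Set (Finset V)
  nonempty_of_mem : ∀ s ∈ faces, s.Nonempty
  down_closed : ∀ s ∈ faces, ∀ t : Finset V, t ⊆ s → t.Nonempty → t ∈ faces

namespace SComplex

variable {V W : Type*}

/-- The geometric realization with scale `κ` of a simplicial complex, i.e. the polyhedron,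
as a subset of `ℓ¹(V)`: nonnegative functions supported on a simplex whose coordinates sum
to `κ` (each vertex `v` is the point `κ·e_v`).  It carries the metric topology induced from
the `ℓ¹`-norm. -/
def space (K : SComplex V) (κ : ℝ) : Set (lp (fun _ : V => ℝ) 1) :=
  {x | (∀ v, 0 ≤ x v) ∧ (∃ s ∈ K.faces, ∀ v, x v ≠ 0 → v ∈ s) ∧
    HasSum (fun v => x v) κ}

/-- The closed geometric simplex of the realization spanned by a face `s`. -/
def cell (K : SComplex V) (κ : ℝ) (s : Finset V) : Set (K.space κ) :=
  {x | ∀ v, (x : lp (fun _ : V => ℝ) 1) v ≠ 0 → v ∈ s}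

/-- The simplices of the barycentric subdivision `βK` are the nonempty finite chains
of faces of `K`. -/
def IsChainOfFaces (K : SComplex V) (c : Finset (Finset V)) : Prop :=
  c.Nonempty ∧ (∀ s ∈ c, s ∈ K.faces) ∧ ∀ s₁ ∈ c, ∀ s₂ ∈ c, s₁ ⊆ s₂ ∨ s₂ ⊆ s₁

/-- The closed geometric simplex of the barycentric subdivision `βK` spanned by the chain
`c`, viewed inside the realization of `K`: the convex hull of the barycenters of the
faces in `c`. -/
def chainCell (K : SComplex V) (κ : ℝ) (c : Finset (Finset V)) : Set (K.space κ) :=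
  {y | ∃ t : Finset V → ℝ, (∀ s, 0 ≤ t s) ∧ (∀ s, t s ≠ 0 → s ∈ c) ∧
      (∑ s ∈ c, t s) = κ ∧
      ∀ w, (y : lp (fun _ : V => ℝ) 1) w =
        ∑ s ∈ c, (if w ∈ s then t s / (s.card : ℝ) else 0)}

/-- A set of faces forms a subcomplex of `K`. -/
def IsSubcomplex (K : SComplex V) (F : Set (Finset V)) : Prop :=
  F ⊆ K.faces ∧ ∀ s ∈ F, ∀ t : Finset V, t ⊆ s → t.Nonempty → t ∈ F

/-- The point set of the subcomplex with faces `F`, inside the realization of `K`. -/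
def subSpace (K : SComplex V) (κ : ℝ) (F : Set (Finset V)) : Set (K.space κ) :=
  {x | ∃ s ∈ F, ∀ v, (x : lp (fun _ : V => ℝ) 1) v ≠ 0 → v ∈ s}

/-- The barycentric star of a subcomplex `F` in `K`: the union of the simplices of the
barycentric subdivision `βK` that intersect the subcomplex. -/
def bst (K : SComplex V) (κ : ℝ) (F : Set (Finset V)) : Set (K.space κ) :=
  ⋃ c ∈ {c | K.IsChainOfFaces c ∧ (K.chainCell κ c ∩ K.subSpace κ F).Nonempty},
    K.chainCell κ c

/-- The open star of a subcomplex `F` in `K`: the complement of the union of all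
simplices of `K` that do not intersect the subcomplex. -/
def ost (K : SComplex V) (κ : ℝ) (F : Set (Finset V)) : Set (K.space κ) :=
  (⋃ s ∈ {s | s ∈ K.faces ∧ K.cell κ s ∩ K.subSpace κ F = ∅}, K.cell κ s)ᶜ

/-- The open star of a subcomplex `F` taken in the barycentric subdivision `βK`:
the complement of the union of all simplices of `βK` that do not intersect the
subcomplex. -/
def ostBsd (K : SComplex V) (κ : ℝ) (F : Set (Finset V)) : Set (K.space κ) :=
  (⋃ c ∈ {c | K.IsChainOfFaces c ∧ K.chainCell κ c ∩ K.subSpace κ F = ∅},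
    K.chainCell κ c)ᶜ

/-- Barycentric star of a vertex. -/
def bstVertex (K : SComplex V) (κ : ℝ) (v : V) : Set (K.space κ) :=
  K.bst κ {({v} : Finset V)}

/-- Open star of a vertex. -/
def ostVertex (K : SComplex V) (κ : ℝ) (v : V) : Set (K.space κ) :=
  K.ost κ {({v} : Finset V)}

/-- A simplicial complex is locally finite-dimensional if the simplices containing any
given vertex have bounded dimension. -/
def LocallyFiniteDimensional (K : SComplex V) : Prop :=
  ∀ v : V, {v} ∈ K.faces → ∃ N : ℕ, ∀ s ∈ K.faces, v ∈ s → s.card ≤ N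

/-- `p` is a simplicial map of the realizations (scales `κ`, `lam`): it is induced by a
vertex map `φ` carrying faces onto faces, extended affinely on each simplex. -/
def IsSimplicialMap (K : SComplex V) (L : SComplex W) (κ lam : ℝ)
    (p : K.space κ → L.space lam) : Prop :=
  ∃ φ : V → W,
    (∀ s ∈ K.faces, ∃ t ∈ L.faces,
      (∀ v ∈ s, φ v ∈ t) ∧ ∀ w ∈ t, ∃ v ∈ s, φ v = w) ∧
    ∀ (x : K.space κ) (w : W),
      (p x : lp (fun _ : W => ℝ) 1) w =
        (lam / κ) * ∑' v : V, (if φ v = w then (x : lp (fun _ : V => ℝ) 1) v else 0)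

/-- `p` is quasi-simplicial: it is simplicial as a map into the barycentric subdivision
`βL`, i.e. induced by a vertex map `φ` from vertices of `K` to faces of `L` (the vertices
of `βL`) carrying each face of `K` into a chain, extended affinely; the formula is the
composition of the simplicial extension with the canonical identification `|βL| = |L|`
sending the vertex `s` of `βL` to the barycenter of `s`. -/
def IsQuasiSimplicialMap (K : SComplex V) (L : SComplex W) (κ lam : ℝ)
    (p : K.space κ → L.space lam) : Prop :=
  ∃ φ : V → Finset W,
    (∀ v : V, ({v} : Finset V) ∈ K.faces → φ v ∈ L.faces) ∧
    (∀ s ∈ K.faces, ∀ v₁ ∈ s, ∀ v₂ ∈ s, φ v₁ ⊆ φ v₂ ∨ φ v₂ ⊆ φ v₁) ∧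
    ∀ (x : K.space κ) (w : W),
      (p x : lp (fun _ : W => ℝ) 1) w =
        (lam / κ) *
          ∑' v : V, (if w ∈ φ v then (x : lp (fun _ : V => ℝ) 1) v / ((φ v).card : ℝ)
            else 0)

/-- A quasi-simplicial map is `n`-regular if the preimage of every (closed) simplex of
the barycentric subdivision `βL` has vanishing homotopy groups in dimensions `< n`,
regardless of basepoint. -/
def IsNRegularMap (n : ℕ) (K : SComplex V) (L : SComplex W) (κ lam : ℝ)
    (p : K.space κ → L.space lam) : Prop :=
  IsQuasiSimplicialMap K L κ lam p ∧
    ∀ c : Finset (Finset W), L.IsChainOfFaces c →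
      VanishingHomotopyBelow n (p ⁻¹' (L.chainCell lam c))

end SComplex

/-! ### Inverse limits -/

/-- The long projection of an inverse limit (realized as the subspace of the product
consisting of all threads) onto its `i`-th coordinate space. -/
def invLimProj {Z : ℕ → Type*} [∀ i, TopologicalSpace (Z i)]
    (p : ∀ i, C(Z (i + 1), Z i)) (i : ℕ) :
    C({x : ∀ j, Z j // ∀ j, p j (x (j + 1)) = x j}, Z i) :=
  ⟨fun x => x.1 i, (continuous_apply i).comp continuous_subtype_val⟩

/-- The short projections of an inverse sequence: `shortProj p i m : Z (i + m) → Z i`. -/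
def shortProj {Z : ℕ → Type*} [∀ i, TopologicalSpace (Z i)]
    (p : ∀ i, C(Z (i + 1), Z i)) (i : ℕ) : ∀ m : ℕ, C(Z (i + m), Z i)
  | 0 => ContinuousMap.id _
  | m + 1 => (shortProj p i m).comp (p (i + m))

end


def ExtE (E : Type*) [NormedAddCommGroup E] {X : Type*} [TopologicalSpace X] (S : Set X) : Prop :=
  ∀ u : E → X, ContinuousOn u (sphere 0 1) → MapsTo u (sphere 0 1) S →
    ∃ U : E → X, ContinuousOn U (closedBall 0 1) ∧ MapsTo U (closedBall 0 1) S ∧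
      EqOn U u (sphere 0 1)

theorem ExtE.retract {E : Type*} [NormedAddCommGroup E] [NormedSpace ℝ E]
    {X : Type*} [TopologicalSpace X] {S P : Set X} (hP : ExtE E P) (hPS : P ⊆ S)
    (h : X × ℝ → X) (hc : ContinuousOn h (S ×ˢ Icc 0 1))
    (h0 : ∀ x ∈ S, h (x, 0) = x) (h1 : ∀ x ∈ S, h (x, 1) ∈ P)
    (hS : ∀ x ∈ S, ∀ t ∈ Icc (0:ℝ) 1, h (x, t) ∈ S) : ExtE E S := by
  intro u hu hm
  obtain ⟨U', cU', mU', eU'⟩ := hP (fun y => h (u y, 1))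
    (hc.comp (hu.prodMk continuousOn_const) (fun y hy => ⟨hm hy, by simp⟩))
    (fun y hy => h1 _ (hm hy))
  have key : ∀ y : E, ‖y‖ ≠ 0 → (‖y‖⁻¹ • y) ∈ sphere (0:E) 1 := by
    intro y hy
    simp [norm_smul, hy]
  refine ⟨fun y => if ‖y‖ ≤ 1/2 then U' ((2:ℝ) • y) else h (u (‖y‖⁻¹ • y), 2 - 2 * ‖y‖), ?_, ?_, ?_⟩
  · apply ContinuousOn.if
    · rintro y ⟨hy, hy'⟩
      have : ‖y‖ = 1/2 := by
        have := frontier_le_subset_eq continuous_norm continuous_const hy'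
        simpa using this
      have h2 : ‖y‖⁻¹ • y = (2:ℝ) • y := by rw [this]; norm_num
      have := eU' (key y (by rw [this]; norm_num))
      simp only [h2] at this
      rw [this, h2]
      congr 2
      linarith
    · apply cU'.comp (by fun_prop)
      rintro y ⟨hy, hy'⟩
      rw [closure_eq_iff_isClosed.2 (isClosed_le continuous_norm continuous_const)] at hy'
      simp only [mem_ofPred_eq] at hy'
      simp [norm_smul]; linarith
    · have hcl : ∀ y ∈ closure {a : E | ¬ ‖a‖ ≤ 1/2}, 1/2 ≤ ‖y‖ := by
        intro y hy
        have : closure {a : E | ¬ ‖a‖ ≤ 1/2} ⊆ {a : E | 1/2 ≤ ‖a‖} := by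
          apply closure_minimal
          · intro a ha; simp at ha ⊢; linarith
          · exact isClosed_le continuous_const continuous_norm
        exact this hy
      apply hc.comp
      · apply ContinuousOn.prodMk
        · apply hu.comp
          · apply ContinuousOn.smul
            · apply ContinuousOn.inv₀ (by fun_prop)
              intro y hy; have := hcl y hy.2; linarith
            · fun_prop
          · intro y hy; apply key;  have := hcl y hy.2; linarith
        · fun_prop
      · rintro y ⟨hy, hy'⟩
        have h3 := hcl y hy'
        simp at hy
        refine ⟨hm (key _ (by linarith)), ?_⟩
        simp; constructor <;> linarith
  · intro y hy
    simp at hy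
    dsimp only
    split_ifs with h3
    · apply hPS (mU' _)
      simp [norm_smul]; linarith
    · push Not at h3
      refine hS _ (hm (key _ (by linarith))) _ ?_
      simp; constructor <;> linarith
  · intro y hy
    simp at hy
    simp only [hy]
    norm_num
    apply h0
    exact hm (by simpa using hy)

theorem ExtE.transfer {E F : Type*} [NormedAddCommGroup E] [NormedAddCommGroup F]
    {X : Type*} [TopologicalSpace X] {S : Set X} (e : E ≃ₜ F) (he : ∀ x, ‖e x‖ = ‖x‖)
    (h : ExtE E S) : ExtE F S := by
  have he' : ∀ x, ‖e.symm x‖ = ‖x‖ := fun x => by rw [← he]; simp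
  intro u hu hm
  obtain ⟨U, cU, mU, eU⟩ := h (u ∘ e) (hu.comp e.continuous.continuousOn (by
    intro x hx; simpa [he] using hx)) (hm.comp (by intro x hx; simpa [he] using hx))
  refine ⟨U ∘ e.symm, cU.comp e.symm.continuous.continuousOn (by
    intro x hx; simpa [he'] using hx), mU.comp (by intro x hx; simpa [he'] using hx), ?_⟩
  intro x hx
  have := eU (x := e.symm x) (by simpa [he'] using hx)
  simpa using this

theorem ExtE.singleton {E : Type*} [NormedAddCommGroup E] 
    {X : Type*} [TopologicalSpace X] (s : X) : ExtE E {s} := by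
  intro u hu hm
  exact ⟨fun _ => s, continuousOn_const, fun _ _ => rfl, fun x hx => (hm hx).symm⟩

theorem homotopyRel_of_subsingleton {k : ℕ} {P : Type*} [TopologicalSpace P] {x : P}
    (h : Subsingleton (HomotopyGroup (Fin k) P x)) (f g : GenLoop (Fin k) P x) :
    ∃ H : C(I × (Fin k → I), P), (∀ y, H (0, y) = f y) ∧ (∀ y, H (1, y) = g y) ∧
      ∀ t, ∀ y ∈ Cube.boundary (Fin k), H (t, y) = x := by
  have := h.elim (Quotient.mk _ f) (Quotient.mk _ g)
  obtain ⟨H⟩ := Quotient.exact this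
  refine ⟨H.toContinuousMap, fun y => H.apply_zero y, fun y => H.apply_one y, fun t y hy => ?_⟩
  have h1 := H.prop t y hy
  exact h1.trans (f.2 y hy)

theorem extE_zero {P : Type*} [TopologicalSpace P]
    (h : ∀ x : P, Subsingleton (HomotopyGroup (Fin 0) P x)) :
    ExtE (ℝ × (Fin 0 → ℝ)) (univ : Set P) := by
  intro u hu hm
  obtain ⟨H, H0, H1, -⟩ := homotopyRel_of_subsingleton (h (u (1, 0)))
    ⟨ContinuousMap.const _ (u (1, 0)), fun _ _ => rfl⟩
    ⟨ContinuousMap.const _ (u (-1, 0)), by rintro y ⟨i, -⟩; exact i.elim0⟩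
  refine ⟨fun y => H (projIcc 0 1 zero_le_one ((1 - y.1) / 2), fun _ => 0), ?_, fun _ _ => trivial, ?_⟩
  · apply Continuous.continuousOn
    apply H.continuous.comp
    apply Continuous.prodMk _ continuous_const
    apply continuous_projIcc.comp
    fun_prop
  · rintro ⟨a, b⟩ hy
    obtain rfl : b = 0 := Subsingleton.elim _ _
    have hy : |a| = 1 := by
      have h1 : ‖((a, 0) : ℝ × (Fin 0 → ℝ))‖ = 1 := by simpa only [mem_sphere, dist_zero_right] using hy
      rw [Prod.norm_def, norm_zero, Real.norm_eq_abs, max_eq_left (abs_nonneg a)] at h1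
      exact h1
    rcases abs_eq (zero_le_one) |>.1 hy with rfl | rfl
    · have : projIcc (0:ℝ) 1 zero_le_one ((1 - 1) / 2) = 0 := by
        simp
      simp only [this]
      rw [H0]; rfl
    · have : projIcc (0:ℝ) 1 zero_le_one ((1 - -1) / 2) = 1 := by
        norm_num
      simp only [this]
      rw [H1]; rfl

noncomputable def qa (r : ℝ) : ℝ := min 1 (3 - 3 * r) / max r (1/3)
noncomputable def qb (r : ℝ) : ℝ := max (-1) (min 1 (3 - 6 * r))

theorem qa_mul (r : ℝ) (h0 : 0 ≤ r) (h1 : r ≤ 1) : qa r * r = min (3 * r) (min 1 (3 - 3 * r)) := by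
  unfold qa
  rcases le_total r (1/3) with h | h
  · rw [max_eq_right h, min_eq_left (by linarith : 1 ≤ 3 - 3 * r), min_eq_left (by linarith)]
    ring
  · rw [max_eq_left h, min_eq_right (a := 3 * r)]
    · field_simp
    · exact (min_le_left _ _).trans (by linarith)

theorem qa_nonneg (r : ℝ) (h0 : 0 ≤ r) (h1 : r ≤ 1) : 0 ≤ qa r := by
  unfold qa
  apply div_nonneg
  · apply le_min <;> linarith
  · exact h0.trans (le_max_left _ _)

theorem qa_pos (r : ℝ) (h1 : r < 1) : 0 < qa r := by
  unfold qa
  apply div_pos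
  · apply lt_min <;> linarith
  · exact lt_of_lt_of_le (by norm_num) (le_max_right _ _)

theorem q_inj (r s : ℝ) (h0 : 0 ≤ r) (h1 : r ≤ 1) (g0 : 0 ≤ s) (g1 : s ≤ 1)
    (hb : qb r = qb s) (ha : qa r * r = qa s * s) : r = s := by
  rw [qa_mul r h0 h1, qa_mul s g0 g1] at ha
  unfold qb at hb
  simp only [min_def, max_def] at ha hb
  split_ifs at ha hb <;> linarith

theorem q_norm (r : ℝ) (h0 : 0 ≤ r) (h1 : r ≤ 1) : max |qb r| (qa r * r) = 1 := by
  rw [qa_mul r h0 h1]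
  unfold qb
  simp only [min_def, max_def, abs]
  split_ifs <;> linarith

noncomputable def qmap (k : ℕ) (z : Fin k → ℝ) : ℝ × (Fin k → ℝ) := (qb ‖z‖, qa ‖z‖ • z)

theorem qmap_cont (k : ℕ) : Continuous (qmap k) := by
  unfold qmap
  apply Continuous.prodMk
  · unfold qb; fun_prop
  · have : Continuous fun z : Fin k → ℝ => qa ‖z‖ := by
      unfold qa
      apply Continuous.div (by fun_prop) (by fun_prop)
      intro z
      exact (lt_of_lt_of_le (by norm_num) (le_max_right _ _)).ne'
    exact this.smul continuous_id

theorem qmap_norm {k : ℕ} (z : Fin k → ℝ) (hz : ‖z‖ ≤ 1) : ‖qmap k z‖ = 1 := by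
  unfold qmap
  rw [Prod.norm_def]
  simp only [norm_smul, Real.norm_eq_abs]
  rw [abs_of_nonneg (qa_nonneg _ (norm_nonneg _) hz), q_norm _ (norm_nonneg _) hz]

theorem qmap_inj {k : ℕ} (z z' : Fin k → ℝ) (hz : ‖z‖ ≤ 1) (hz' : ‖z'‖ ≤ 1)
    (h : qmap k z = qmap k z') : z = z' ∨ (‖z‖ = 1 ∧ ‖z'‖ = 1) := by
  unfold qmap at h
  obtain ⟨hb, ha⟩ := Prod.mk.inj h
  have hn := congrArg norm ha
  simp only [norm_smul, Real.norm_eq_abs] at hn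
  rw [abs_of_nonneg (qa_nonneg _ (norm_nonneg _) hz),
    abs_of_nonneg (qa_nonneg _ (norm_nonneg _) hz')] at hn
  have hr := q_inj _ _ (norm_nonneg _) hz (norm_nonneg _) hz' hb hn
  rcases hz.lt_or_eq with h1 | h1
  · left
    rw [← hr] at ha
    exact smul_right_injective _ (qa_pos _ h1).ne' ha
  · right; exact ⟨h1, hr ▸ h1⟩

theorem qmap_surj {k : ℕ} (x : ℝ × (Fin (k+1) → ℝ)) (hx : ‖x‖ = 1) :
    ∃ z, ‖z‖ ≤ 1 ∧ qmap (k+1) z = x := by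
  obtain ⟨b, w⟩ := x
  rw [Prod.norm_def] at hx
  simp only [Real.norm_eq_abs] at hx
  have hb : |b| ≤ 1 := hx ▸ le_max_left _ _
  have hw : ‖w‖ ≤ 1 := hx ▸ le_max_right _ _
  have hwn := norm_nonneg w
  rw [abs_le] at hb
  by_cases h1 : b = 1
  · refine ⟨(1/3 : ℝ) • w, ?_, ?_⟩
    · rw [norm_smul]; norm_num; linarith
    · unfold qmap
      rw [norm_smul]
      norm_num
      refine ⟨?_, ?_⟩
      · unfold qb
        rw [h1, min_eq_left (by linarith)]; norm_num
      · unfold qa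
        rw [min_eq_left (by linarith), max_eq_right (by linarith), smul_smul]
        norm_num
  by_cases h2 : b = -1
  · by_cases hw0 : w = 0
    · refine ⟨fun _ => 1, ?_, ?_⟩
      · simp
      · have : ‖(fun _ => 1 : Fin (k+1) → ℝ)‖ = 1 := by simp
        unfold qmap
        rw [this, h2, hw0]
        unfold qa qb
        norm_num
    · have hw1 : 0 < ‖w‖ := norm_pos_iff.2 hw0
      have hn : ‖((1 - ‖w‖/3) / ‖w‖) • w‖ = 1 - ‖w‖/3 := by
        rw [norm_smul, Real.norm_eq_abs, abs_of_nonneg (div_nonneg (by linarith) hwn)]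
        field_simp
      refine ⟨((1 - ‖w‖/3) / ‖w‖) • w, ?_, ?_⟩
      · rw [hn]; linarith
      · unfold qmap
        rw [hn]
        congr 1
        · unfold qb
          rw [h2, min_eq_right (by linarith), max_eq_left (by linarith)]
        · unfold qa
          rw [min_eq_right (by linarith), max_eq_left (by linarith), smul_smul]
          have h4 : 1 - ‖w‖/3 ≠ 0 := by linarith
          have : (3 - 3 * (1 - ‖w‖ / 3)) / (1 - ‖w‖ / 3) * ((1 - ‖w‖ / 3) / ‖w‖) = 1 := by
            have h5 : 3 - ‖w‖ ≠ 0 := by linarith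
            field_simp
            try ring
          rw [this, one_smul]
  · have hb1 : b < 1 := lt_of_le_of_ne hb.2 h1
    have hb2 : -1 < b := lt_of_le_of_ne hb.1 (Ne.symm h2)
    have hw1 : ‖w‖ = 1 := by
      rcases max_choice |b| ‖w‖ with h | h
      · rw [h] at hx
        exact absurd hx (abs_lt.2 ⟨hb2, hb1⟩).ne
      · rw [← h, hx]
    have hn : ‖((3 - b)/6) • w‖ = (3-b)/6 := by
      rw [norm_smul, Real.norm_eq_abs, abs_of_nonneg (by linarith), hw1, mul_one]
    refine ⟨((3 - b)/6) • w, ?_, ?_⟩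
    · rw [hn]; linarith
    · unfold qmap
      rw [hn]
      congr 1
      · unfold qb
        rw [min_eq_right (by linarith), max_eq_right (by linarith)]
        ring
      · unfold qa
        rw [min_eq_left (by linarith), max_eq_left (by linarith), smul_smul]
        have h4 : 3 - b ≠ 0 := by linarith
        have : 1 / ((3 - b) / 6) * ((3 - b) / 6) = 1 := by
          field_simp
        rw [this, one_smul]

/-- affine map from unit cube to the sup-norm ball -/
noncomputable def aff {k : ℕ} (y : Fin k → I) : Fin k → ℝ := fun i => 2 * (y i : ℝ) - 1

theorem aff_norm {k : ℕ} (y : Fin k → I) : ‖aff y‖ ≤ 1 := by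
  rw [pi_norm_le_iff_of_nonneg zero_le_one]
  intro i
  unfold aff
  have := (y i).2
  rw [Real.norm_eq_abs, abs_le]
  constructor <;> linarith [this.1, this.2]

theorem aff_cont {k : ℕ} : Continuous (aff : (Fin k → I) → _) := by
  unfold aff; fun_prop

theorem aff_inj {k : ℕ} : Function.Injective (aff : (Fin k → I) → _) := by
  intro y z h
  funext i
  have := congrFun h i
  unfold aff at this
  ext; linarith

theorem aff_surj {k : ℕ} (z : Fin k → ℝ) (hz : ‖z‖ ≤ 1) : ∃ y, aff y = z := by
  rw [pi_norm_le_iff_of_nonneg zero_le_one] at hz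
  refine ⟨fun i => ⟨(z i + 1) / 2, ?_⟩, ?_⟩
  · have := hz i
    rw [Real.norm_eq_abs, abs_le] at this
    constructor <;> linarith
  · funext i; unfold aff; ring

theorem aff_bdry {k : ℕ} (y : Fin k → I) : ‖aff y‖ = 1 ↔ y ∈ Cube.boundary (Fin k) := by
  constructor
  · intro h
    by_contra hy
    have : ‖aff y‖ < 1 := by
      rw [pi_norm_lt_iff zero_lt_one]
      intro i
      unfold aff
      have h2 := (y i).2
      have h3 : y i ≠ 0 := fun h => hy ⟨i, Or.inl h⟩
      have h4 : y i ≠ 1 := fun h => hy ⟨i, Or.inr h⟩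
      have h5 : 0 < (y i : ℝ) := lt_of_le_of_ne h2.1 (fun h => h3 (by ext; exact h.symm))
      have h6 : (y i : ℝ) < 1 := lt_of_le_of_ne h2.2 (fun h => h4 (by ext; exact h))
      rw [Real.norm_eq_abs, abs_lt]
      constructor <;> linarith
    linarith
  · rintro ⟨i, hi⟩
    apply le_antisymm (aff_norm y)
    refine le_trans ?_ (norm_le_pi_norm _ i)
    unfold aff
    rcases hi with hi | hi <;> rw [hi] <;> norm_num

theorem extE_succ {k : ℕ} {P : Type*} [TopologicalSpace P]
    (h : ∀ x : P, Subsingleton (HomotopyGroup (Fin (k+1)) P x)) :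
    ExtE (ℝ × (Fin (k+1) → ℝ)) (univ : Set P) := by
  intro u hu hm
  have hbd : ∀ y ∈ Cube.boundary (Fin (k+1)), qmap (k+1) (aff y) = (-1, 0) := by
    intro y hy
    rw [← aff_bdry] at hy
    unfold qmap
    rw [hy]
    unfold qa qb; norm_num
  have hq : ∀ y : Fin (k+1) → I, ‖qmap (k+1) (aff y)‖ = 1 := fun y => qmap_norm _ (aff_norm y)
  obtain ⟨H, H0, H1, H2⟩ := homotopyRel_of_subsingleton (h (u (-1, 0)))
    ⟨⟨fun y => u (qmap (k+1) (aff y)), hu.comp_continuous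
      ((qmap_cont _).comp aff_cont) (fun y => by simpa using hq y)⟩,
      fun y hy => by simp [hbd y hy]⟩
    ⟨ContinuousMap.const _ (u (-1, 0)), fun _ _ => rfl⟩
  let c : I × (Fin (k+1) → I) → closedBall (0 : ℝ × (Fin (k+1) → ℝ)) 1 :=
    fun w => ⟨(1 - (w.1 : ℝ)) • qmap (k+1) (aff w.2), by
      have := w.1.2
      simp only [mem_closedBall, dist_zero_right, norm_smul, hq, Real.norm_eq_abs, mul_one]
      rw [abs_le]; constructor <;> linarith [this.1, this.2]⟩
  have hcn : ∀ w, ‖(c w : ℝ × (Fin (k+1) → ℝ))‖ = 1 - w.1 := by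
    intro w
    have := w.1.2
    simp only [c, norm_smul, hq, Real.norm_eq_abs, mul_one]
    rw [abs_of_nonneg]; linarith [this.2]
  have hc : Continuous c := by
    apply Continuous.subtype_mk
    have h1 : Continuous fun w : I × (Fin (k+1) → I) => 1 - (w.1 : ℝ) := by fun_prop
    exact h1.smul ((qmap_cont _).comp (aff_cont.comp continuous_snd))
  have hs : Function.Surjective c := by
    rintro ⟨x, hx⟩
    simp at hx
    by_cases h0 : x = 0
    · refine ⟨(1, fun _ => 0), ?_⟩
      apply Subtype.ext
      simp [c, h0]
    · have hn : ‖x‖ ≠ 0 := norm_ne_zero_iff.2 h0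
      obtain ⟨z, hz, hqz⟩ := qmap_surj (‖x‖⁻¹ • x) (by simp [norm_smul, hn])
      obtain ⟨y, rfl⟩ := aff_surj z hz
      refine ⟨(⟨1 - ‖x‖, by constructor <;> linarith [norm_nonneg x]⟩, y), ?_⟩
      apply Subtype.ext
      simp only [c, hqz, smul_smul]
      simp [hn]
  have hquot : Topology.IsQuotientMap c := hc.isClosedMap.isQuotientMap hc hs
  have hfac : ∀ a b, c a = c b → H a = H b := by
    rintro ⟨t, y⟩ ⟨t', y'⟩ hab
    have hn := congrArg (fun z : closedBall (0 : ℝ × (Fin (k+1) → ℝ)) 1 => ‖(z : ℝ × (Fin (k+1) → ℝ))‖) hab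
    simp only [hcn] at hn
    obtain rfl : t = t' := by ext; linarith
    by_cases ht : t = 1
    · subst ht
      rw [H1, H1]; rfl
    · have ht' : (1 - (t : ℝ)) ≠ 0 := by
        intro h; apply ht; apply Subtype.ext; show (t : ℝ) = 1; linarith
      have h3 := congrArg Subtype.val hab
      simp only [c] at h3
      have h4 := smul_right_injective _ ht' h3
      rcases qmap_inj _ _ (aff_norm _) (aff_norm _) h4 with h5 | ⟨h5, h6⟩
      · rw [aff_inj h5]
      · rw [H2 _ _ ((aff_bdry _).1 h5), H2 _ _ ((aff_bdry _).1 h6)]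
  obtain ⟨U, hU⟩ : ∃ U : C(closedBall (0 : ℝ × (Fin (k+1) → ℝ)) 1, P), ∀ w, U (c w) = H w := by
    let q : C(_, _) := ⟨c, hc⟩
    have hq' : Topology.IsQuotientMap q := hquot
    refine ⟨hq'.lift H (fun a b hab => hfac a b hab), fun w => ?_⟩
    exact congrArg (fun g : C(_, _) => g w) (hq'.lift_comp H (fun a b hab => hfac a b hab))
  refine ⟨fun x => if hx : x ∈ closedBall (0 : ℝ × (Fin (k+1) → ℝ)) 1 then U ⟨x, hx⟩ else u x, ?_,
    fun _ _ => trivial, ?_⟩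
  · rw [continuousOn_iff_continuous_domRestrict]
    convert U.continuous using 1
    funext x
    exact dif_pos x.2
  · intro x hx
    have hx' : ‖x‖ = 1 := by simpa using hx
    have hx2 : x ∈ closedBall (0 : ℝ × (Fin (k+1) → ℝ)) 1 := by simp [hx']
    obtain ⟨z, hz, hqz⟩ := qmap_surj x hx'
    obtain ⟨y, rfl⟩ := aff_surj z hz
    have : (⟨x, hx2⟩ : closedBall (0 : ℝ × (Fin (k+1) → ℝ)) 1) = c (0, y) := by
      apply Subtype.ext; simp [c, hqz]
    simp only [hx2, dite_true]
    rw [this, hU, H0, ← hqz]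
    rfl

theorem extE_subtype {E : Type*} [NormedAddCommGroup E] {X : Type*} [TopologicalSpace X]
    {P : Set X} (hne : P.Nonempty) (h : ExtE E (univ : Set P)) : ExtE E P := by
  obtain ⟨x0, hx0⟩ := hne
  intro u hu hm
  obtain ⟨U, cU, -, eU⟩ := h (fun x => if hx : u x ∈ P then ⟨u x, hx⟩ else ⟨x0, hx0⟩)
    (by
      rw [Topology.IsInducing.subtypeVal.continuousOn_iff]
      apply hu.congr
      intro x hx
      simp [hm hx]) (fun _ _ => trivial)
  refine ⟨fun x => U x, continuous_subtype_val.comp_continuousOn cU, fun x _ => (U x).2, ?_⟩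
  intro x hx
  simp only [eU hx]
  simp [hm hx]

theorem extE_of_vanishing {n : ℕ} {X : Type*} [TopologicalSpace X]
    {P : Set X} (hne : P.Nonempty) (h : ∀ k < n, ∀ x : P, Subsingleton (HomotopyGroup (Fin k) P x))
    (ι : Type*) [Fintype ι] (hι : Fintype.card ι ≤ n) : ExtE (ι → ℝ) P := by
  rcases hc : Fintype.card ι with _ | k
  · have : IsEmpty ι := Fintype.card_eq_zero_iff.1 hc
    obtain ⟨x0, hx0⟩ := hne
    intro u hu hm
    refine ⟨fun _ => x0, continuousOn_const, fun _ _ => hx0, ?_⟩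
    intro x hx
    have : x = 0 := Subsingleton.elim _ _
    simp [this] at hx
  · have hE : ExtE (ℝ × (Fin k → ℝ)) (univ : Set P) := by
      have := h k (by omega)
      cases k with
      | zero => exact extE_zero this
      | succ k => exact extE_succ this
    have e : Fin (k+1) ≃ ι := (Fintype.equivFinOfCardEq hc).symm
    let e1 : ℝ × (Fin k → ℝ) ≃ₜ (Fin (k+1) → ℝ) :=
      { toFun := fun x => Fin.cons x.1 x.2
        invFun := fun x => (x 0, Fin.tail x)
        left_inv := fun x => by simp
        right_inv := fun x => by simp
        continuous_toFun := by fun_prop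
        continuous_invFun := by unfold Fin.tail; fun_prop }
    have he1 : ∀ x, ‖e1 x‖ = ‖x‖ := by
      intro x
      apply le_antisymm
      · rw [pi_norm_le_iff_of_nonneg (norm_nonneg _)]
        intro i
        refine Fin.cases ?_ (fun j => ?_) i
        · exact norm_fst_le x
        · exact (norm_le_pi_norm x.2 j).trans (norm_snd_le x)
      · rw [Prod.norm_def]
        apply max_le
        · exact norm_le_pi_norm (e1 x) 0
        · rw [pi_norm_le_iff_of_nonneg (norm_nonneg _)]
          intro i
          exact norm_le_pi_norm (e1 x) i.succ
    let e2 : (Fin (k+1) → ℝ) ≃ᵢ (ι → ℝ) := IsometryEquiv.piCongrLeft' e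
    exact ((extE_subtype hne hE).transfer e1 he1).transfer e2.toHomeomorph (fun x => by
      have h := e2.dist_eq x 0
      have h0 : e2 0 = 0 := rfl
      rw [h0, dist_zero_right, dist_zero_right] at h
      exact h)

def gcell {m : ℕ} (e : (Fin m → ℤ) × (Fin m → ℤ)) : Set (Fin m → ℝ) :=
  {z | ∀ i, (e.1 i : ℝ) ≤ z i ∧ z i ≤ (e.2 i : ℝ)}

def IsGCell {m : ℕ} (N : ℕ) (e : (Fin m → ℤ) × (Fin m → ℤ)) : Prop :=
  ∀ i, 0 ≤ e.1 i ∧ e.1 i ≤ e.2 i ∧ e.2 i ≤ e.1 i + 1 ∧ e.2 i ≤ (N : ℤ)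

def gbd {m : ℕ} (e : (Fin m → ℤ) × (Fin m → ℤ)) : Set (Fin m → ℝ) :=
  {z | z ∈ gcell e ∧ ∃ i, e.1 i ≠ e.2 i ∧ (z i = e.1 i ∨ z i = e.2 i)}

def bigCube (m N : ℕ) : Set (Fin m → ℝ) := {z | ∀ i, 0 ≤ z i ∧ z i ≤ N}

def bigBd (m N : ℕ) : Set (Fin m → ℝ) := {z | z ∈ bigCube m N ∧ ∃ i, z i = 0 ∨ z i = N}

theorem isClosed_gcell {m : ℕ} (e : (Fin m → ℤ) × (Fin m → ℤ)) : IsClosed (gcell e) := by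
  have : gcell e = ⋂ i, {z : Fin m → ℝ | (e.1 i : ℝ) ≤ z i} ∩ {z | z i ≤ (e.2 i : ℝ)} := by
    ext z; simp [gcell]
  rw [this]
  apply isClosed_iInter
  intro i
  exact (isClosed_le (by fun_prop) (by fun_prop)).inter (isClosed_le (by fun_prop) (by fun_prop))

theorem isClosed_bigBd (m N : ℕ) : IsClosed (bigBd m N) := by
  have : bigBd m N = (⋂ i, {z : Fin m → ℝ | (0 : ℝ) ≤ z i} ∩ {z | z i ≤ (N : ℝ)}) ∩
      (⋃ i, {z : Fin m → ℝ | z i = 0} ∪ {z | z i = N}) := by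
    ext z; simp [bigBd, bigCube]
  rw [this]
  apply IsClosed.inter
  · apply isClosed_iInter
    intro i
    exact (isClosed_le (by fun_prop) (by fun_prop)).inter (isClosed_le (by fun_prop) (by fun_prop))
  · apply isClosed_iUnion_of_finite
    intro i
    exact (isClosed_eq (by fun_prop) (by fun_prop)).union (isClosed_eq (by fun_prop) (by fun_prop))

theorem gcell_extend {m N : ℕ} (e : (Fin m → ℤ) × (Fin m → ℤ)) (he : IsGCell N e)
    {X : Type*} [TopologicalSpace X] {S : Set X} (hS : ExtE ({i // e.1 i ≠ e.2 i} → ℝ) S)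
    (w : (Fin m → ℝ) → X) (hw : ContinuousOn w (gbd e)) (hm : MapsTo w (gbd e) S) :
    ∃ U : (Fin m → ℝ) → X, ContinuousOn U (gcell e) ∧ MapsTo U (gcell e) S ∧ EqOn U w (gbd e) := by
  let th : (Fin m → ℝ) → ({i // e.1 i ≠ e.2 i} → ℝ) := fun z i => 2 * (z i - e.1 i) - 1
  let th' : ({i // e.1 i ≠ e.2 i} → ℝ) → (Fin m → ℝ) :=
    fun y i => if h : e.1 i ≠ e.2 i then e.1 i + (y ⟨i, h⟩ + 1) / 2 else e.1 i
  have cth : Continuous th := by fun_prop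
  have cth' : Continuous th' := by
    apply continuous_pi
    intro i
    by_cases h : e.1 i ≠ e.2 i
    · have : (fun y => th' y i) = fun y => (e.1 i : ℝ) + (y ⟨i, h⟩ + 1) / 2 := by
        funext y; exact dif_pos h
      rw [this]; fun_prop
    · have : (fun y => th' y i) = fun y => (e.1 i : ℝ) := by
        funext y; exact dif_neg h
      rw [this]; fun_prop
  have hb : ∀ i, e.1 i ≠ e.2 i → (e.2 i : ℝ) = e.1 i + 1 := by
    intro i hi
    have := he i
    have : e.2 i = e.1 i + 1 := by omega
    rw [this]; push_cast; ring
  have inv : ∀ z ∈ gcell e, th' (th z) = z := by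
    intro z hz
    funext i
    by_cases h : e.1 i ≠ e.2 i
    · have : th' (th z) i = (e.1 i : ℝ) + (th z ⟨i, h⟩ + 1) / 2 := dif_pos h
      rw [this]; simp only [th]; ring
    · have hzi := hz i
      push Not at h
      rw [← h] at hzi
      have : z i = e.1 i := le_antisymm hzi.2 hzi.1
      simp [th', h, this]
  have th'cell : ∀ y ∈ closedBall (0 : {i // e.1 i ≠ e.2 i} → ℝ) 1, th' y ∈ gcell e := by
    intro y hy i
    simp only [mem_closedBall, dist_zero_right] at hy
    by_cases h : e.1 i ≠ e.2 i
    · have h1 := (norm_le_pi_norm y ⟨i, h⟩).trans hy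
      rw [Real.norm_eq_abs, abs_le] at h1
      have h2 : th' y i = e.1 i + (y ⟨i, h⟩ + 1) / 2 := dif_pos h
      rw [h2, hb i h]
      constructor <;> linarith
    · have h2 : th' y i = e.1 i := by simp only [th', h, dite_false]
      push Not at h
      rw [h2, ← h]; simp
  have thball : ∀ z ∈ gcell e, th z ∈ closedBall (0 : {i // e.1 i ≠ e.2 i} → ℝ) 1 := by
    intro z hz
    simp only [mem_closedBall, dist_zero_right]
    rw [pi_norm_le_iff_of_nonneg zero_le_one]
    rintro ⟨i, hi⟩
    have := hz i
    rw [hb i hi] at this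
    simp only [th, Real.norm_eq_abs, abs_le]
    constructor <;> linarith
  have thsph : ∀ z ∈ gbd e, th z ∈ sphere (0 : {i // e.1 i ≠ e.2 i} → ℝ) 1 := by
    rintro z ⟨hz, i, hi, hzi⟩
    simp only [mem_sphere, dist_zero_right]
    apply le_antisymm
    · simpa using thball z hz
    · refine le_trans ?_ (norm_le_pi_norm _ ⟨i, hi⟩)
      simp only [th, Real.norm_eq_abs]
      rcases hzi with h | h
      · rw [h]; simp
      · rw [h, hb i hi]; norm_num
  have th'bd : ∀ y ∈ sphere (0 : {i // e.1 i ≠ e.2 i} → ℝ) 1, th' y ∈ gbd e := by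
    intro y hy
    refine ⟨th'cell y (sphere_subset_closedBall hy), ?_⟩
    simp only [mem_sphere, dist_zero_right] at hy
    by_contra hcon
    push Not at hcon
    have hcl := th'cell y (by simp [hy])
    have : ‖y‖ < 1 := by
      rw [pi_norm_lt_iff zero_lt_one]
      rintro ⟨i, hi⟩
      have h1 := hcon i hi
      have h3 := hcl i
      have h2 : th' y i = e.1 i + (y ⟨i, hi⟩ + 1) / 2 := dif_pos hi
      have h4 := lt_of_le_of_ne h3.1 (Ne.symm h1.1)
      have h5 := lt_of_le_of_ne h3.2 h1.2
      rw [h2] at h4 h5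
      rw [hb i hi] at h5
      rw [Real.norm_eq_abs, abs_lt]
      constructor <;> linarith
    linarith
  obtain ⟨U, cU, mU, eU⟩ := hS (w ∘ th') (hw.comp cth'.continuousOn th'bd) (hm.comp th'bd)
  refine ⟨U ∘ th, cU.comp cth.continuousOn thball, mU.comp thball, ?_⟩
  intro z hz
  have := eU (thsph z hz)
  simp only [Function.comp, inv z hz.1] at this
  exact this

theorem grid_induct {m N : ℕ} {X : Type*} [TopologicalSpace X]
    (O : (Fin m → ℤ) × (Fin m → ℤ) → Set X)
    (hmono : ∀ e e' : (Fin m → ℤ) × (Fin m → ℤ), IsGCell N e → IsGCell N e' →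
      e.1 ≤ e'.1 → e'.2 ≤ e.2 → O e' ⊆ O e)
    (hext : ∀ e, IsGCell N e → ExtE ({i // e.1 i ≠ e.2 i} → ℝ) (O e))
    (g : (Fin m → ℝ) → X) (hg : ContinuousOn g (bigBd m N))
    (hgO : ∀ e, IsGCell N e → ∀ z ∈ gcell e, z ∈ bigBd m N → g z ∈ O e) :
    ∀ T : Finset ((Fin m → ℤ) × (Fin m → ℤ)), (∀ e ∈ T, IsGCell N e) →
      (∀ e ∈ T, ∀ e', IsGCell N e' → e.1 ≤ e'.1 → e'.2 ≤ e.2 → e' ∈ T) →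
      ∃ G : (Fin m → ℝ) → X, ContinuousOn G (bigBd m N ∪ ⋃ e ∈ T, gcell e) ∧
        EqOn G g (bigBd m N) ∧ ∀ e ∈ T, MapsTo G (gcell e) (O e) := by
  intro T
  induction T using Finset.strongInduction with
  | H T ih =>
  intro hT hdown
  rcases T.eq_empty_or_nonempty with rfl | hne
  · exact ⟨g, by simpa using hg, fun _ _ => rfl, by simp⟩
  obtain ⟨e, heT, hemax⟩ := Finset.exists_max_image T (fun e => ∑ i, (e.2 i - e.1 i)) hne
  have hmax : ∀ e' ∈ T, e'.1 ≤ e.1 → e.2 ≤ e'.2 → e' = e := by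
    intro e' he' h1 h2
    have h3 := hemax e' he'
    have h4 : ∀ i ∈ Finset.univ, e.2 i - e.1 i ≤ e'.2 i - e'.1 i := by
      intro i _
      have h6 : e'.1 i ≤ e.1 i := h1 i; have h7 : e.2 i ≤ e'.2 i := h2 i; omega
    have h5 := (Finset.sum_eq_sum_iff_of_le h4).1 (le_antisymm (Finset.sum_le_sum h4) h3)
    apply Prod.ext <;> funext i
    · have := h5 i (Finset.mem_univ i); have h6 : e'.1 i ≤ e.1 i := h1 i; have h7 : e.2 i ≤ e'.2 i := h2 i; omega
    · have := h5 i (Finset.mem_univ i); have h6 : e'.1 i ≤ e.1 i := h1 i; have h7 : e.2 i ≤ e'.2 i := h2 i; omega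
  have hecell := hT e heT
  obtain ⟨G', cG', eG', mG'⟩ := ih (T.erase e) (Finset.erase_ssubset heT)
    (fun e' he' => hT e' (Finset.mem_of_mem_erase he'))
    (by
      intro e'' he'' e' hc h1 h2
      refine Finset.mem_erase.2 ⟨?_, hdown e'' (Finset.mem_of_mem_erase he'') e' hc h1 h2⟩
      rintro rfl
      exact (Finset.mem_erase.1 he'').1 (hmax e'' (Finset.mem_of_mem_erase he'') h1 h2))
  set D : Set (Fin m → ℝ) := bigBd m N ∪ ⋃ e' ∈ T.erase e, gcell e' with hD
  have hDT : (bigBd m N ∪ ⋃ e' ∈ T, gcell e') = D ∪ gcell e := by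
    conv_lhs => rw [← Finset.insert_erase heT]
    rw [Finset.set_biUnion_insert, hD, Set.union_assoc, Set.union_comm (gcell e)]
  have hDcl : IsClosed D := by
    apply (isClosed_bigBd m N).union
    exact (T.erase e).finite_toSet.isClosed_biUnion (fun e' _ => isClosed_gcell e')
  rw [hDT]
  by_cases hcase : ∃ i, e.1 i = e.2 i ∧ (e.1 i = 0 ∨ e.1 i = N)
  · have hsub : gcell e ⊆ bigBd m N := by
      obtain ⟨i, hi, hi'⟩ := hcase
      intro z hz
      refine ⟨fun j => ?_, i, ?_⟩
      · have h1 := hecell j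
        have h2 := hz j
        have h3 : (0 : ℝ) ≤ e.1 j := by exact_mod_cast h1.1
        have h4 : (e.2 j : ℝ) ≤ N := by exact_mod_cast h1.2.2.2
        constructor <;> linarith
      · have h2 := hz i
        rw [← hi] at h2
        have h3 : z i = e.1 i := le_antisymm h2.2 h2.1
        rcases hi' with h | h
        · left; rw [h3, h]; simp
        · right; rw [h3, h]; simp
    refine ⟨G', ?_, eG', ?_⟩
    · rw [Set.union_eq_self_of_subset_right (hsub.trans subset_union_left)]
      exact cG'
    · intro e' he'
      by_cases h : e' = e
      · subst h
        intro z hz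
        rw [eG' (hsub hz)]
        exact hgO _ hecell z hz (hsub hz)
      · exact mG' e' (Finset.mem_erase.2 ⟨h, he'⟩)
  · push Not at hcase
    have hbdface : ∀ z ∈ gbd e, ∃ e' ∈ T.erase e, z ∈ gcell e' ∧ e.1 ≤ e'.1 ∧ e'.2 ≤ e.2 := by
      rintro z ⟨hz, i, hi, hzi⟩
      rcases hzi with hzi | hzi
      · refine ⟨(e.1, Function.update e.2 i (e.1 i)), ?_, ?_, le_rfl, ?_⟩
        · have hle : Function.update e.2 i (e.1 i) ≤ e.2 := by
            intro j
            by_cases h : j = i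
            · subst h; simp; exact (hecell _).2.1
            · simp [h]
          refine Finset.mem_erase.2 ⟨?_, hdown e heT _ ?_ le_rfl hle⟩
          · intro h
            apply hi
            have := congrFun (congrArg Prod.snd h) i
            simpa using this
          · intro j
            have := hecell j
            by_cases h : j = i
            · subst h; simp; omega
            · simpa [h] using this
        · intro j
          have := hz j
          by_cases h : j = i
          · subst h; simp [hzi]
          · simpa [h] using this
        · intro j
          by_cases h : j = i
          · subst h; simp; exact (hecell _).2.1
          · simp [h]
      · have hle : e.1 ≤ Function.update e.1 i (e.2 i) := by
          intro j
          by_cases h : j = i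
          · subst h; simp; exact (hecell _).2.1
          · simp [h]
        refine ⟨(Function.update e.1 i (e.2 i), e.2), ?_, ?_, hle, le_rfl⟩
        · refine Finset.mem_erase.2 ⟨?_, hdown e heT _ ?_ hle le_rfl⟩
          · intro h
            apply hi
            have := congrFun (congrArg Prod.fst h) i
            simpa using this.symm
          · intro j
            have := hecell j
            by_cases h : j = i
            · subst h; simp; omega
            · simpa [h] using this
        · intro j
          have := hz j
          by_cases h : j = i
          · subst h; simp [hzi]
          · simpa [h] using this
    have hbdD : gbd e ⊆ D := by
      intro z hz
      obtain ⟨e', he', hze', -⟩ := hbdface z hz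
      right
      simp only [mem_iUnion]
      exact ⟨e', he', hze'⟩
    have hDe : ∀ z ∈ D, z ∈ gcell e → z ∈ gbd e := by
      intro z hzD hze
      refine ⟨hze, ?_⟩
      rcases hzD with hzA | hzT
      · obtain ⟨-, i, hi⟩ := hzA
        have h1 := hecell i
        have h2 := hze i
        have h3 : (0 : ℝ) ≤ e.1 i := by exact_mod_cast h1.1
        have h4 : (e.2 i : ℝ) ≤ N := by exact_mod_cast h1.2.2.2
        refine ⟨i, ?_, ?_⟩
        · intro heq
          have h5 := hcase i heq
          rw [← heq] at h2 h4
          have h6 : z i = e.1 i := le_antisymm h2.2 h2.1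
          rcases hi with hi | hi
          · apply h5.1; rw [hi] at h6; exact_mod_cast h6.symm
          · apply h5.2; rw [hi] at h6; exact_mod_cast h6.symm
        · rcases hi with hi | hi
          · left; linarith
          · right; linarith
      · by_contra hcon
        push Not at hcon
        simp only [mem_iUnion] at hzT
        obtain ⟨e', he', hze'⟩ := hzT
        have key : ∀ i, e'.1 i ≤ e.1 i ∧ e.2 i ≤ e'.2 i := by
          intro i
          have h2 := hze i
          have h2' := hze' i
          by_cases hi : e.1 i = e.2 i
          · rw [← hi] at h2 ⊢
            have h6 : z i = e.1 i := le_antisymm h2.2 h2.1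
            rw [h6] at h2'
            exact_mod_cast h2'
          · have h7 := hcon i hi
            have h8 := lt_of_le_of_ne h2.1 (Ne.symm h7.1)
            have h9 := lt_of_le_of_ne h2.2 h7.2
            have h10 : e'.1 i < e.2 i := by exact_mod_cast h2'.1.trans_lt h9
            have h11 : e.1 i < e'.2 i := by exact_mod_cast h8.trans_le h2'.2
            have := hecell i
            omega
        exact (Finset.mem_erase.1 he').1 (hmax e' (Finset.mem_of_mem_erase he')
          (fun i => (key i).1) (fun i => (key i).2))
    obtain ⟨U, cU, mU, eU⟩ := gcell_extend e hecell (hext e hecell) G' (cG'.mono hbdD) (by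
      intro z hz
      obtain ⟨e', he', hze', h1, h2⟩ := hbdface z hz
      exact hmono e e' hecell (hT e' (Finset.mem_of_mem_erase he')) h1 h2 (mG' e' he' hze'))
    have hGD : EqOn (fun z => if z ∈ gcell e then U z else G' z) G' D := by
      intro z hz
      dsimp only
      split_ifs with h
      · exact eU (hDe z hz h)
      · rfl
    refine ⟨fun z => if z ∈ gcell e then U z else G' z, ?_, ?_, ?_⟩
    · apply ContinuousOn.union_of_isClosed _ _ hDcl (isClosed_gcell e)
      · exact cG'.congr hGD
      · apply cU.congr
        intro z hz
        simp [hz]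
    · intro z hz
      rw [hGD (Or.inl hz), eG' hz]
    · intro e' he' z hz
      by_cases h : e' = e
      · subst h
        simp only [hz, if_true]
        exact mU hz
      · have hm := Finset.mem_erase.2 ⟨h, he'⟩
        rw [hGD (Or.inr (by simp only [mem_iUnion]; exact ⟨e', hm, hz⟩))]
        exact mG' e' hm hz

theorem grid_extend {m N : ℕ} {X : Type*} [TopologicalSpace X]
    (O : (Fin m → ℤ) × (Fin m → ℤ) → Set X)
    (hmono : ∀ e e' : (Fin m → ℤ) × (Fin m → ℤ), IsGCell N e → IsGCell N e' →
      e.1 ≤ e'.1 → e'.2 ≤ e.2 → O e' ⊆ O e)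
    (hext : ∀ e, IsGCell N e → ExtE ({i // e.1 i ≠ e.2 i} → ℝ) (O e))
    (g : (Fin m → ℝ) → X) (hg : ContinuousOn g (bigBd m N))
    (hgO : ∀ e, IsGCell N e → ∀ z ∈ gcell e, z ∈ bigBd m N → g z ∈ O e) :
    ∃ G : (Fin m → ℝ) → X, ContinuousOn G (bigCube m N) ∧
        EqOn G g (bigBd m N) ∧ ∀ e, IsGCell N e → MapsTo G (gcell e) (O e) := by
  let T : Finset ((Fin m → ℤ) × (Fin m → ℤ)) :=
    ((Finset.Icc 0 (fun _ => (N : ℤ))) ×ˢ (Finset.Icc 0 (fun _ => (N : ℤ)))).filter (IsGCell N)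
  have hT : ∀ e, e ∈ T ↔ IsGCell N e := by
    intro e
    simp only [T, Finset.mem_filter, Finset.mem_product, Finset.mem_Icc, and_iff_right_iff_imp]
    intro h
    refine ⟨⟨fun i => ?_, fun i => ?_⟩, ⟨fun i => ?_, fun i => ?_⟩⟩ <;> have := h i <;> simp <;> omega
  obtain ⟨G, cG, eG, mG⟩ := grid_induct O hmono hext g hg hgO T (fun e he => (hT e).1 he)
    (fun e _ e' he' _ _ => (hT e').2 he')
  refine ⟨G, cG.mono ?_, eG, fun e he => mG e ((hT e).2 he)⟩
  intro z hz
  right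
  simp only [mem_iUnion]
  refine ⟨(fun i => ⌊z i⌋, fun i => ⌈z i⌉), (hT _).2 ?_, ?_⟩
  · intro i
    exact ⟨Int.floor_nonneg.2 (hz i).1, Int.floor_le_ceil _, Int.ceil_le_floor_add_one _,
      Int.ceil_le.2 (by exact_mod_cast (hz i).2)⟩
  · intro i
    exact ⟨Int.floor_le _, Int.le_ceil _⟩

theorem comb_key {V W : Type*} (s : Finset V) (x : V → ℝ) (hx : ∀ v ∈ s, 0 < x v)
    (φ : V → Finset W) (hch : ∀ v₁ ∈ s, ∀ v₂ ∈ s, φ v₁ ⊆ φ v₂ ∨ φ v₂ ⊆ φ v₁)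
    (sg : Finset W) (hsg : sg.Nonempty) (Y : W → ℝ)
    (hY : ∀ w, Y w = ∑ v ∈ s, (if w ∈ φ v then x v / ((φ v).card : ℝ) else 0))
    (h0 : ∀ w ∈ sg, 0 < Y w) (h1 : ∀ w ∈ sg, ∀ w' ∉ sg, Y w' < Y w) :
    ∃ v ∈ s, φ v = sg := by
  by_contra hno
  push Not at hno
  have hw : ∃ w ∈ sg, ∀ v ∈ s, ¬ sg ⊆ φ v → w ∉ φ v := by
    rcases (s.filter (fun v => ¬ sg ⊆ φ v)).eq_empty_or_nonempty with he | hne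
    · obtain ⟨w, hw⟩ := hsg
      refine ⟨w, hw, fun v hv hn => ?_⟩
      have : v ∈ s.filter (fun v => ¬ sg ⊆ φ v) := Finset.mem_filter.2 ⟨hv, hn⟩
      rw [he] at this
      simp at this
    · obtain ⟨v0, hv0, hmax⟩ := Finset.exists_max_image _ (fun v => (φ v).card) hne
      rw [Finset.mem_filter] at hv0
      obtain ⟨w, hwsg, hwn⟩ := Finset.not_subset.1 hv0.2
      refine ⟨w, hwsg, fun v hv hn hwv => hwn ?_⟩
      have hle := hmax v (Finset.mem_filter.2 ⟨hv, hn⟩)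
      rcases hch v hv v0 hv0.1 with h | h
      · exact h hwv
      · rw [Finset.eq_of_subset_of_card_le h hle]; exact hwv
  obtain ⟨w, hwsg, hw⟩ := hw
  have hw' : ∃ w', w' ∉ sg ∧ ∀ v ∈ s, sg ⊆ φ v → w' ∈ φ v := by
    rcases (s.filter (fun v => sg ⊆ φ v)).eq_empty_or_nonempty with he | hne
    · exfalso
      have h := h0 w hwsg
      rw [hY, Finset.sum_eq_zero] at h
      · exact lt_irrefl _ h
      · intro v hv
        rw [if_neg]
        apply hw v hv
        intro hn
        have : v ∈ s.filter (fun v => sg ⊆ φ v) := Finset.mem_filter.2 ⟨hv, hn⟩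
        rw [he] at this
        simp at this
    · obtain ⟨v1, hv1, hmin⟩ := Finset.exists_min_image _ (fun v => (φ v).card) hne
      rw [Finset.mem_filter] at hv1
      have : ¬ φ v1 ⊆ sg := fun h => hno v1 hv1.1 (Finset.Subset.antisymm h hv1.2)
      obtain ⟨w', hwv, hwn⟩ := Finset.not_subset.1 this
      refine ⟨w', hwn, fun v hv hn => ?_⟩
      have hle := hmin v (Finset.mem_filter.2 ⟨hv, hn⟩)
      rcases hch v1 hv1.1 v hv with h | h
      · exact h hwv
      · rw [Finset.eq_of_subset_of_card_le h hle]; exact hwv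
  obtain ⟨w', hwn, hw'⟩ := hw'
  have := h1 w hwsg w' hwn
  rw [hY, hY] at this
  refine absurd this (not_lt.2 (Finset.sum_le_sum fun v hv => ?_))
  have hnn : 0 ≤ x v / ((φ v).card : ℝ) := div_nonneg (hx v hv).le (Nat.cast_nonneg _)
  by_cases hs : sg ⊆ φ v
  · rw [if_pos (hw' v hv hs)]
    split_ifs <;> simp [hnn]
  · rw [if_neg (hw v hv hs)]
    split_ifs <;> simp [hnn]

theorem space_face {V : Type*} {K : SComplex V} {κ : ℝ} (hκ : 0 < κ)
    {x : lp (fun _ : V => ℝ) 1} (hx : x ∈ K.space κ) :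
    ∃ s ∈ K.faces, (∀ v, x v ≠ 0 ↔ v ∈ s) := by
  obtain ⟨h0, ⟨s, hs, hsup⟩, hsum⟩ := hx
  have hne : (s.filter (fun v => x v ≠ 0)).Nonempty := by
    by_contra hn
    rw [Finset.not_nonempty_iff_eq_empty] at hn
    have hz : (fun v => x v) = fun _ => 0 := by
      funext v
      by_contra hv
      have : v ∈ s.filter (fun v => x v ≠ 0) := Finset.mem_filter.2 ⟨hsup v hv, hv⟩
      rw [hn] at this
      simp at this
    rw [hz] at hsum
    exact hκ.ne (hasSum_zero.unique hsum)
  refine ⟨_, K.down_closed s hs _ (Finset.filter_subset _ _) hne, fun v => ?_⟩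
  rw [Finset.mem_filter]
  exact ⟨fun h => ⟨hsup v h, h⟩, fun h => h.2⟩

theorem space_sum {V : Type*} {K : SComplex V} {κ : ℝ}
    {x : lp (fun _ : V => ℝ) 1} (hx : x ∈ K.space κ) (s : Finset V)
    (hs : ∀ v, x v ≠ 0 → v ∈ s) : ∑ v ∈ s, x v = κ :=
  (hasSum_sum_of_ne_finset_zero (fun v hv => by
    by_contra h; exact hv (hs v h))).unique hx.2.2

theorem mem_space_of {V : Type*} {K : SComplex V} {κ : ℝ}
    {x : lp (fun _ : V => ℝ) 1} (h0 : ∀ v, 0 ≤ x v) (s : Finset V) (hsf : s ∈ K.faces)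
    (hs : ∀ v, x v ≠ 0 → v ∈ s) (hsum : ∑ v ∈ s, x v = κ) : x ∈ K.space κ := by
  refine ⟨h0, ⟨s, hsf, hs⟩, ?_⟩
  rw [← hsum]
  exact hasSum_sum_of_ne_finset_zero (fun v hv => by
    by_contra h; exact hv (hs v h))

theorem conv_mem {V : Type*} {K : SComplex V} {κ : ℝ}
    {x y : lp (fun _ : V => ℝ) 1} (hx : x ∈ K.space κ) (hy : y ∈ K.space κ)
    (s : Finset V) (hsf : s ∈ K.faces) (hxs : ∀ v, x v ≠ 0 → v ∈ s) (hys : ∀ v, y v ≠ 0 → v ∈ s)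
    (t : ℝ) (ht : t ∈ Icc (0:ℝ) 1) : (1 - t) • x + t • y ∈ K.space κ := by
  have e : ∀ v, ((1 - t) • x + t • y : lp (fun _ : V => ℝ) 1) v = (1 - t) * x v + t * y v := by
    intro v; rfl
  apply mem_space_of _ s hsf
  · intro v hv
    by_contra hn
    have h1 : x v = 0 := by by_contra h; exact hn (hxs v h)
    have h2 : y v = 0 := by by_contra h; exact hn (hys v h)
    apply hv; rw [e, h1, h2]; simp
  · simp_rw [e]
    rw [Finset.sum_add_distrib, ← Finset.mul_sum, ← Finset.mul_sum, space_sum hx s hxs,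
      space_sum hy s hys]
    ring
  · intro v
    rw [e]
    exact add_nonneg (mul_nonneg (by linarith [ht.2]) (hx.1 v)) (mul_nonneg ht.1 (hy.1 v))

theorem coord_close {V : Type*} (x y : lp (fun _ : V => ℝ) 1) (v : V) :
    |x v - y v| ≤ dist x y := by
  rw [dist_eq_norm]
  have := lp.norm_apply_le_norm (p := 1) one_ne_zero (x - y) v
  simpa using this

open Classical in
noncomputable def toSpace {V : Type*} {K : SComplex V} {κ : ℝ} (x0 : K.space κ)
    (z : lp (fun _ : V => ℝ) 1) : K.space κ :=
  if h : z ∈ K.space κ then ⟨z, h⟩ else x0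

theorem toSpace_val {V : Type*} {K : SComplex V} {κ : ℝ} (x0 : K.space κ)
    {z : lp (fun _ : V => ℝ) 1} (h : z ∈ K.space κ) : (toSpace x0 z : lp (fun _ : V => ℝ) 1) = z := by
  rw [toSpace, dif_pos h]

theorem toSpace_cont {V : Type*} {K : SComplex V} {κ : ℝ} (x0 : K.space κ)
    {A : Type*} [TopologicalSpace A] {S : Set A} {f : A → lp (fun _ : V => ℝ) 1}
    (hf : ContinuousOn f S) (hm : ∀ a ∈ S, f a ∈ K.space κ) :
    ContinuousOn (fun a => toSpace x0 (f a)) S := by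
  rw [Topology.IsInducing.subtypeVal.continuousOn_iff]
  exact hf.congr fun a ha => toSpace_val x0 (hm a ha)

/-- open nbhds of barycenters -/
def oU {W : Type*} (L : SComplex W) (lam : ℝ) (sg : Finset W) : Set (L.space lam) :=
  {y | ∃ δ > 0, ∀ w ∈ sg, δ < (y : lp (fun _ : W => ℝ) 1) w ∧
    ∀ w' ∉ sg, (y : lp (fun _ : W => ℝ) 1) w' + δ < (y : lp (fun _ : W => ℝ) 1) w}

theorem isOpen_oU {W : Type*} (L : SComplex W) (lam : ℝ) (sg : Finset W) :
    IsOpen (oU L lam sg) := by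
  rw [Metric.isOpen_iff]
  rintro y ⟨δ, hδ, h⟩
  refine ⟨δ / 4, by positivity, fun z hz => ⟨δ / 4, by positivity, fun w hw => ?_⟩⟩
  rw [Metric.mem_ball, Subtype.dist_eq] at hz
  have hc : ∀ w, _ := fun w => (abs_le.1 (coord_close (z : lp (fun _ : W => ℝ) 1) y w))
  refine ⟨?_, fun w' hw' => ?_⟩
  · have := (h w hw).1; linarith [(hc w).1]
  · have := (h w hw).2 w' hw'; linarith [(hc w).1, (hc w').2]

theorem oU_cover {W : Type*} (L : SComplex W) {lam : ℝ} (hlam : 0 < lam) (y : L.space lam) :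
    ∃ sg ∈ L.faces, y ∈ oU L lam sg := by
  obtain ⟨s, hs, hsup⟩ := space_face hlam y.2
  refine ⟨s, hs, ?_⟩
  obtain ⟨w0, hw0, hmin⟩ := Finset.exists_min_image s
    (fun w => (y : lp (fun _ : W => ℝ) 1) w) (L.nonempty_of_mem s hs)
  have hpos : 0 < (y : lp (fun _ : W => ℝ) 1) w0 :=
    lt_of_le_of_ne (y.2.1 w0) (Ne.symm ((hsup w0).2 hw0))
  refine ⟨(y : lp (fun _ : W => ℝ) 1) w0 / 2, by positivity, fun w hw => ⟨?_, fun w' hw' => ?_⟩⟩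
  · linarith [hmin w hw]
  · have : (y : lp (fun _ : W => ℝ) 1) w' = 0 := by
      by_contra h; exact hw' ((hsup w').1 h)
    rw [this]; linarith [hmin w hw]

theorem oU_chain {W : Type*} (L : SComplex W) {lam : ℝ} {sg τ : Finset W} {y : L.space lam}
    (h1 : y ∈ oU L lam sg) (h2 : y ∈ oU L lam τ) : sg ⊆ τ ∨ τ ⊆ sg := by
  by_contra hn
  push Not at hn
  obtain ⟨a, ha, ha'⟩ := Finset.not_subset.1 hn.1
  obtain ⟨b, hb, hb'⟩ := Finset.not_subset.1 hn.2
  obtain ⟨δ, hδ, h1⟩ := h1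
  obtain ⟨δ', hδ', h2⟩ := h2
  have e1 := (h1 a ha).2 b hb'
  have e2 := (h2 b hb).2 a ha'
  linarith

def oO {V W : Type*} (K : SComplex V) (κ : ℝ) (φ : V → Finset W) (c : Finset (Finset W)) :
    Set (K.space κ) := {x | ∃ v, (x : lp (fun _ : V => ℝ) 1) v ≠ 0 ∧ φ v ∈ c}

/-- the quasi-simplicial data -/
def QS {V W : Type*} (K : SComplex V) (L : SComplex W) (κ lam : ℝ)
    (p : K.space κ → L.space lam) (φ : V → Finset W) : Prop :=
    (∀ v : V, ({v} : Finset V) ∈ K.faces → φ v ∈ L.faces) ∧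
    (∀ s ∈ K.faces, ∀ v₁ ∈ s, ∀ v₂ ∈ s, φ v₁ ⊆ φ v₂ ∨ φ v₂ ⊆ φ v₁) ∧
    ∀ (x : K.space κ) (w : W),
      (p x : lp (fun _ : W => ℝ) 1) w =
        (lam / κ) *
          ∑' v : V, (if w ∈ φ v then (x : lp (fun _ : V => ℝ) 1) v / ((φ v).card : ℝ)
            else 0)

theorem QS.sum {V W : Type*} {K : SComplex V} {L : SComplex W} {κ lam : ℝ}
    {p : K.space κ → L.space lam} {φ : V → Finset W} (h : QS K L κ lam p φ)
    (x : K.space κ) (s : Finset V) (hs : ∀ v, (x : lp (fun _ : V => ℝ) 1) v ≠ 0 → v ∈ s) (w : W) :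
    (p x : lp (fun _ : W => ℝ) 1) w = (lam / κ) *
      ∑ v ∈ s, (if w ∈ φ v then (x : lp (fun _ : V => ℝ) 1) v / ((φ v).card : ℝ) else 0) := by
  rw [h.2.2, tsum_eq_sum]
  intro v hv
  have : (x : lp (fun _ : V => ℝ) 1) v = 0 := by
    by_contra h; exact hv (hs v h)
  simp [this]

theorem QS.preimage_oU {V W : Type*} {K : SComplex V} {L : SComplex W} {κ lam : ℝ}
    (hκ : 0 < κ) (hlam : 0 < lam)
    {p : K.space κ → L.space lam} {φ : V → Finset W} (h : QS K L κ lam p φ)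
    {sg : Finset W} (hsg : sg.Nonempty) {x : K.space κ} (hx : p x ∈ oU L lam sg)
    {c : Finset (Finset W)} (hc : sg ∈ c) : x ∈ oO K κ φ c := by
  obtain ⟨s, hs, hsup⟩ := space_face hκ x.2
  obtain ⟨δ, hδ, hd⟩ := hx
  have hpos : 0 < lam / κ := div_pos hlam hκ
  have hY := h.sum x s (fun v => (hsup v).1)
  obtain ⟨v, hv, e⟩ := comb_key s (fun v => (x : lp (fun _ : V => ℝ) 1) v)
    (fun v hv => lt_of_le_of_ne (x.2.1 v) (Ne.symm ((hsup v).2 hv))) φ (h.2.1 s hs) sg hsg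
    _ (fun w => rfl)
    (fun w hw => by
      have := (hd w hw).1
      rw [hY] at this
      exact pos_of_mul_pos_right (hδ.trans this) hpos.le)
    (fun w hw w' hw' => by
      have := (hd w hw).2 w' hw'
      rw [hY, hY] at this
      exact lt_of_mul_lt_mul_left (by linarith) hpos.le)
  exact ⟨v, (hsup v).2 hv, e ▸ hc⟩

theorem chainCell_oU {W : Type*} {L : SComplex W} {lam : ℝ} (hlam : 0 < lam)
    {c : Finset (Finset W)} (hc : L.IsChainOfFaces c) {y : L.space lam}
    (hy : y ∈ L.chainCell lam c) : ∃ r ∈ c, y ∈ oU L lam r := by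
  obtain ⟨t, ht0, htc, htsum, hty⟩ := hy
  have : ∃ r ∈ c, 0 < t r := by
    by_contra hn
    push Not at hn
    have := Finset.sum_nonpos hn
    linarith
  obtain ⟨r, hr, htr⟩ := this
  have hrc : 0 < (r.card : ℝ) := by
    exact_mod_cast Finset.card_pos.2 (L.nonempty_of_mem r (hc.2.1 r hr))
  have hnn : ∀ q : Finset W, 0 ≤ t q / (q.card : ℝ) :=
    fun q => div_nonneg (ht0 q) (Nat.cast_nonneg _)
  have hpos : 0 < t r / (r.card : ℝ) := div_pos htr hrc
  refine ⟨r, hr, t r / (r.card : ℝ) / 2, by positivity, fun w hw => ⟨?_, fun w' hw' => ?_⟩⟩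
  · rw [hty]
    have := Finset.single_le_sum (f := fun s => if w ∈ s then t s / (s.card : ℝ) else 0)
      (fun s _ => by split_ifs <;> simp [hnn]) hr
    simp only [if_pos hw] at this
    linarith
  · have : t r / (r.card : ℝ) ≤ (y : lp (fun _ : W => ℝ) 1) w - (y : lp (fun _ : W => ℝ) 1) w' := by
      rw [hty, hty, ← Finset.sum_sub_distrib]
      have := Finset.single_le_sum (f := fun s => (if w ∈ s then t s / (s.card : ℝ) else 0)
          - (if w' ∈ s then t s / (s.card : ℝ) else 0))
        (fun s hs => by
          rcases hc.2.2 s hs r hr with h | h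
          · rw [if_neg (fun h' => hw' (h h'))]
            split_ifs <;> simp [hnn]
          · rw [if_pos (h hw)]
            split_ifs <;> simp [hnn]) hr
      simpa [hw, hw'] using this
    linarith

/-- barycenter as a point of l1 -/
noncomputable def bary {W : Type*} (lam : ℝ) (r : Finset W) : lp (fun _ : W => ℝ) 1 :=
  ⟨fun w => if w ∈ r then lam / (r.card : ℝ) else 0, by
    have h : Memℓp (fun w : W => if w ∈ r then lam / (r.card : ℝ) else 0) 0 :=
      memℓp_zero ((Finset.finite_toSet r).subset (by intro w hw; by_contra h; simp_all))
    exact h.of_exponent_ge (by simp)⟩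

theorem bary_apply {W : Type*} (lam : ℝ) (r : Finset W) (w : W) :
    bary lam r w = if w ∈ r then lam / (r.card : ℝ) else 0 := rfl

theorem bary_mem {W : Type*} (L : SComplex W) {lam : ℝ} (hlam : 0 < lam) {r : Finset W}
    (hr : r ∈ L.faces) : bary lam r ∈ L.space lam := by
  have hrc : 0 < (r.card : ℝ) := by
    exact_mod_cast Finset.card_pos.2 (L.nonempty_of_mem r hr)
  apply mem_space_of _ r hr
  · intro v hv
    by_contra h
    rw [bary_apply, if_neg h] at hv
    exact hv rfl
  · simp_rw [bary_apply]
    rw [Finset.sum_congr rfl (fun x hx => if_pos hx), Finset.sum_const, nsmul_eq_mul]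
    field_simp
  · intro v
    rw [bary_apply]
    split_ifs
    · positivity
    · rfl

theorem bary_chainCell {W : Type*} (L : SComplex W) {lam : ℝ} (hlam : 0 < lam)
    {c : Finset (Finset W)} {r : Finset W} (hr : r ∈ L.faces) (hrc : r ∈ c) :
    (⟨bary lam r, bary_mem L hlam hr⟩ : L.space lam) ∈ L.chainCell lam c := by
  refine ⟨fun s => if s = r then lam else 0, ?_, ?_, ?_, ?_⟩
  · intro s; dsimp only; split_ifs <;> simp [hlam.le]
  · intro s hs
    dsimp only at hs
    split_ifs at hs with h
    · rw [h]; exact hrc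
    · exact absurd rfl hs
  · rw [Finset.sum_ite_eq' c r, if_pos hrc]
  · intro w
    dsimp only
    rw [Finset.sum_eq_single_of_mem r hrc]
    · simp [bary_apply]
    · intro b _ hb; simp [hb]

/-- restriction of coordinates -/
noncomputable def rstr {V : Type*} (C : Set V) :
    lp (fun _ : V => ℝ) 1 →ₗ[ℝ] lp (fun _ : V => ℝ) 1 where
  toFun x := ⟨fun v => if v ∈ C then x v else 0, (lp.memℓp x).mono' (fun v => by
    split_ifs <;> simp)⟩
  map_add' x y := by
    apply lp.ext
    funext v
    change (if v ∈ C then x v + y v else 0) = (if v ∈ C then x v else 0) + (if v ∈ C then y v else 0)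
    split_ifs <;> simp
  map_smul' a x := by
    apply lp.ext
    funext v
    change (if v ∈ C then a * x v else 0) = a * (if v ∈ C then x v else 0)
    split_ifs <;> simp

theorem rstr_apply {V : Type*} (C : Set V) (x : lp (fun _ : V => ℝ) 1) (v : V) :
    rstr C x v = if v ∈ C then x v else 0 := rfl

theorem rstr_pos {V : Type*} {C : Set V} (x : lp (fun _ : V => ℝ) 1) {v : V} (h : v ∈ C) :
    rstr C x v = x v := by rw [rstr_apply, if_pos h]

theorem rstr_neg {V : Type*} {C : Set V} (x : lp (fun _ : V => ℝ) 1) {v : V} (h : v ∉ C) :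
    rstr C x v = 0 := by rw [rstr_apply, if_neg h]

theorem rstr_cont {V : Type*} (C : Set V) : Continuous (rstr C) := by
  refine AddMonoidHomClass.continuous_of_bound (rstr C) 1 fun x => ?_
  rw [one_mul]
  apply lp.norm_mono one_ne_zero
  intro v
  rw [rstr_apply]
  split_ifs <;> simp

theorem l1_norm {V : Type*} (x : lp (fun _ : V => ℝ) 1) (s : Finset V)
    (h0 : ∀ v, 0 ≤ x v) (hs : ∀ v, x v ≠ 0 → v ∈ s) : ‖x‖ = ∑ v ∈ s, x v := by
  have h := lp.hasSum_norm (p := 1) (by simp) x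
  simp only [ENNReal.toReal_one, Real.rpow_one] at h
  refine h.unique ?_
  have : (fun v => ‖x v‖) = fun v => x v := by
    funext v; exact Real.norm_of_nonneg (h0 v)
  rw [this]
  exact hasSum_sum_of_ne_finset_zero (fun v hv => by
    by_contra h; exact hv (hs v h))

theorem QS.mem_chainCell {V W : Type*} {K : SComplex V} {L : SComplex W} {κ lam : ℝ}
    (hκ : 0 < κ) (hlam : 0 < lam)
    {p : K.space κ → L.space lam} {φ : V → Finset W} (h : QS K L κ lam p φ)
    {c : Finset (Finset W)} (x : K.space κ)
    (hx : ∀ v, (x : lp (fun _ : V => ℝ) 1) v ≠ 0 → φ v ∈ c) : p x ∈ L.chainCell lam c := by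
  obtain ⟨s, hs, hsup⟩ := space_face hκ x.2
  have hpos : 0 < lam / κ := div_pos hlam hκ
  have hY := h.sum x s (fun v => (hsup v).1)
  refine ⟨fun r => (lam / κ) * ∑ v ∈ s, if φ v = r then (x : lp (fun _ : V => ℝ) 1) v else 0,
    ?_, ?_, ?_, ?_⟩
  · intro r
    refine mul_nonneg hpos.le (Finset.sum_nonneg fun v _ => ?_)
    split_ifs
    · exact x.2.1 v
    · rfl
  · intro r hr
    by_contra hn
    apply hr
    dsimp only
    rw [Finset.sum_eq_zero, mul_zero]
    intro v hv
    rw [if_neg]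
    rintro rfl
    exact hn (hx v ((hsup v).2 hv))
  · rw [← Finset.mul_sum, Finset.sum_comm]
    have : ∑ v ∈ s, ∑ r ∈ c, (if φ v = r then (x : lp (fun _ : V => ℝ) 1) v else 0) =
        ∑ v ∈ s, (x : lp (fun _ : V => ℝ) 1) v := by
      apply Finset.sum_congr rfl
      intro v hv
      rw [Finset.sum_ite_eq c (φ v), if_pos (hx v ((hsup v).2 hv))]
    rw [this, space_sum x.2 s (fun v => (hsup v).1)]
    field_simp
  · intro w
    rw [hY]
    have : ∀ r ∈ c, (if w ∈ r then ((lam / κ) * ∑ v ∈ s, if φ v = r then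
        (x : lp (fun _ : V => ℝ) 1) v else 0) / (r.card : ℝ) else 0) =
        (lam / κ) * ∑ v ∈ s, if φ v = r then
          (if w ∈ r then (x : lp (fun _ : V => ℝ) 1) v / (r.card : ℝ) else 0) else 0 := by
      intro r _
      split_ifs with hw
      · rw [mul_div_assoc, Finset.sum_div]
        congr 1
        apply Finset.sum_congr rfl
        intro v _
        split_ifs <;> simp
      · simp
    rw [Finset.sum_congr rfl this, ← Finset.mul_sum, Finset.sum_comm]
    congr 1
    apply Finset.sum_congr rfl
    intro v hv
    rw [Finset.sum_ite_eq c (φ v), if_pos (hx v ((hsup v).2 hv))]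

theorem QS.ext_oO {V W : Type*} {K : SComplex V} {L : SComplex W} {κ lam : ℝ}
    (hκ : 0 < κ) (hlam : 0 < lam)
    {p : K.space κ → L.space lam} {φ : V → Finset W} (h : QS K L κ lam p φ)
    {c : Finset (Finset W)} (hc : L.IsChainOfFaces c)
    {E : Type*} [NormedAddCommGroup E] [NormedSpace ℝ E]
    (hE : ExtE E (p ⁻¹' (L.chainCell lam c))) : ExtE E (oO K κ φ c) := by
  set C : Set V := {v | φ v ∈ c} with hC
  have hprep : ∀ x : K.space κ, x ∈ oO K κ φ c → 0 < ‖rstr C (x : lp (fun _ : V => ℝ) 1)‖ := by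
    rintro x ⟨v, hv, hvc⟩
    rw [norm_pos_iff]
    intro h0
    apply hv
    have := rstr_pos (x : lp (fun _ : V => ℝ) 1) (show v ∈ C from hvc)
    rw [h0] at this
    exact this.symm
  set r : K.space κ → lp (fun _ : V => ℝ) 1 :=
    fun x => (κ / ‖rstr C (x : lp (fun _ : V => ℝ) 1)‖) • rstr C (x : lp (fun _ : V => ℝ) 1) with hr
  have hrv : ∀ x v, r x v = (κ / ‖rstr C (x : lp (fun _ : V => ℝ) 1)‖) *
      rstr C (x : lp (fun _ : V => ℝ) 1) v := fun x v => rfl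
  have hrs : ∀ (x : K.space κ) v, r x v ≠ 0 → (x : lp (fun _ : V => ℝ) 1) v ≠ 0 := by
    intro x v hv h0
    apply hv
    rw [hrv, rstr_apply, h0]; simp
  have hrc : ∀ (x : K.space κ) v, r x v ≠ 0 → φ v ∈ c := by
    intro x v hv
    by_contra h0
    apply hv
    rw [hrv, rstr_neg _ (show ¬ v ∈ C from h0)]; simp
  have hrm : ∀ x : K.space κ, x ∈ oO K κ φ c → r x ∈ K.space κ := by
    intro x hx
    obtain ⟨s, hs, hsup⟩ := space_face hκ x.2
    have hp := hprep x hx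
    have h00 : ∀ v, 0 ≤ rstr C (x : lp (fun _ : V => ℝ) 1) v := by
      intro v; rw [rstr_apply]
      split_ifs
      · exact x.2.1 v
      · rfl
    apply mem_space_of _ s hs
    · intro v hv; exact (hsup v).1 (hrs x v hv)
    · have hn := l1_norm (rstr C (x : lp (fun _ : V => ℝ) 1)) s h00 (by
        intro v hv
        rw [rstr_apply] at hv
        split_ifs at hv
        · exact (hsup v).1 hv
        · exact absurd rfl hv)
      have : ∀ v ∈ s, r x v = (κ / ‖rstr C (x : lp (fun _ : V => ℝ) 1)‖) *
          rstr C (x : lp (fun _ : V => ℝ) 1) v := fun v _ => rfl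
      rw [Finset.sum_congr rfl this, ← Finset.mul_sum, ← hn]
      field_simp
    · intro v
      rw [hrv]
      exact mul_nonneg (div_nonneg hκ.le hp.le) (h00 v)
  have hmem : ∀ x ∈ oO K κ φ c, ∀ t ∈ Icc (0:ℝ) 1,
      (1 - t) • (x : lp (fun _ : V => ℝ) 1) + t • r x ∈ K.space κ := by
    intro x hx t ht
    obtain ⟨s, hs, hsup⟩ := space_face hκ x.2
    exact conv_mem x.2 (hrm x hx) s hs (fun v => (hsup v).1)
      (fun v hv => (hsup v).1 (hrs x v hv)) t ht
  by_cases hemp : Nonempty (K.space κ)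
  swap
  · intro u hu hm
    exact (hemp (let ⟨U, _, _⟩ := hE (fun y => u y) hu (fun y _ => (hemp ⟨u y⟩).elim); ⟨U 0⟩)).elim
  obtain ⟨x0⟩ := hemp
  refine hE.retract ?_
    (fun q => toSpace x0 ((1 - q.2) • (q.1 : lp (fun _ : V => ℝ) 1) + q.2 • r q.1)) ?_ ?_ ?_ ?_
  · intro x hx
    obtain ⟨r, hr, hxr⟩ := chainCell_oU hlam hc hx
    exact h.preimage_oU hκ hlam (L.nonempty_of_mem r (hc.2.1 r hr)) hxr hr
  · apply toSpace_cont
    · have h1 : Continuous fun q : K.space κ × ℝ => rstr C (q.1 : lp (fun _ : V => ℝ) 1) :=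
        (rstr_cont C).comp (continuous_subtype_val.comp continuous_fst)
      have h2 : ContinuousOn (fun q : K.space κ × ℝ =>
          κ / ‖rstr C (q.1 : lp (fun _ : V => ℝ) 1)‖) (oO K κ φ c ×ˢ Icc 0 1) :=
        continuousOn_const.div h1.norm.continuousOn (fun q hq => (hprep q.1 hq.1).ne')
      have h3 : ContinuousOn (fun q : K.space κ × ℝ => r q.1) (oO K κ φ c ×ˢ Icc 0 1) :=
        h2.smul h1.continuousOn
      have h4 : Continuous fun q : K.space κ × ℝ => (1 - q.2) • (q.1 : lp (fun _ : V => ℝ) 1) :=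
        (continuous_const.sub continuous_snd).smul (continuous_subtype_val.comp continuous_fst)
      exact h4.continuousOn.add (continuous_snd.continuousOn.smul h3)
    · intro q hq
      exact hmem q.1 hq.1 q.2 hq.2
  · intro x hx
    apply Subtype.ext
    have := hmem x hx 0 (by simp)
    rw [toSpace_val x0 this]
    simp
  · intro x hx
    apply h.mem_chainCell hκ hlam
    intro v hv
    rw [toSpace_val x0 (hmem x hx 1 (by simp))] at hv
    apply hrc x v
    simpa using hv
  · intro x hx t ht
    obtain ⟨v, hv, hvc⟩ := id hx
    refine ⟨v, ?_, hvc⟩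
    rw [toSpace_val x0 (hmem x hx t ht)]
    have e : ((1 - t) • (x : lp (fun _ : V => ℝ) 1) + t • r x : lp (fun _ : V => ℝ) 1) v =
      (1 - t) * (x : lp (fun _ : V => ℝ) 1) v + t * r x v := rfl
    rw [e, hrv, rstr_pos _ (show v ∈ C from hvc)]
    have hp : 0 < (x : lp (fun _ : V => ℝ) 1) v := lt_of_le_of_ne (x.2.1 v) (Ne.symm hv)
    have hq : 0 < κ / ‖rstr C (x : lp (fun _ : V => ℝ) 1)‖ := div_pos hκ (hprep x hx)
    have hq' := mul_pos hq hp
    rcases lt_or_eq_of_le ht.2 with h1 | h1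
    · have := mul_pos (sub_pos.2 h1) hp
      have := mul_nonneg ht.1 hq'.le
      positivity
    · subst h1
      simp only [sub_self, zero_mul, zero_add, one_mul]
      exact hq'.ne'

def oS {W : Type*} (L : SComplex W) (lam : ℝ) (c : Finset (Finset W)) : Set (L.space lam) :=
  {y | ∀ w, (∀ r ∈ c, w ∈ r) → (y : lp (fun _ : W => ℝ) 1) w ≠ 0}

theorem oU_sub_oS {W : Type*} {L : SComplex W} {lam : ℝ} {c : Finset (Finset W)}
    {r : Finset W} (hr : r ∈ c) : oU L lam r ⊆ oS L lam c := by
  rintro y ⟨δ, hδ, h⟩ w hw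
  have := (h w (hw r hr)).1
  intro h0
  linarith

theorem QS.map_oO {V W : Type*} {K : SComplex V} {L : SComplex W} {κ lam : ℝ}
    (hκ : 0 < κ) (hlam : 0 < lam)
    {p : K.space κ → L.space lam} {φ : V → Finset W} (h : QS K L κ lam p φ)
    {c : Finset (Finset W)} {x : K.space κ} (hx : x ∈ oO K κ φ c) : p x ∈ oS L lam c := by
  obtain ⟨s, hs, hsup⟩ := space_face hκ x.2
  obtain ⟨v, hv, hvc⟩ := hx
  intro w hw
  rw [h.sum x s (fun v => (hsup v).1)]
  have hpos : 0 < lam / κ := div_pos hlam hκ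
  have hwv := hw _ hvc
  have hcard : 0 < ((φ v).card : ℝ) := by exact_mod_cast Finset.card_pos.2 ⟨w, hwv⟩
  have hp : 0 < (x : lp (fun _ : V => ℝ) 1) v := lt_of_le_of_ne (x.2.1 v) (Ne.symm hv)
  have := Finset.single_le_sum (s := s) (f := fun v => if w ∈ φ v then
    (x : lp (fun _ : V => ℝ) 1) v / ((φ v).card : ℝ) else 0)
    (fun u _ => by
      dsimp only
      split_ifs
      · exact div_nonneg (x.2.1 u) (Nat.cast_nonneg _)
      · rfl) ((hsup v).1 hv)
  simp only [if_pos hwv] at this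
  have := lt_of_lt_of_le (div_pos hp hcard) this
  exact (mul_pos hpos this).ne'

theorem chain_min {W : Type*} {L : SComplex W} {c : Finset (Finset W)}
    (hc : L.IsChainOfFaces c) : ∃ r ∈ c, ∀ q ∈ c, r ⊆ q := by
  obtain ⟨r, hr, hmin⟩ := Finset.exists_min_image c (fun q => q.card) hc.1
  refine ⟨r, hr, fun q hq => ?_⟩
  rcases hc.2.2 r hr q hq with h | h
  · exact h
  · rw [Finset.eq_of_subset_of_card_le h (hmin q hq)]

theorem ext_oS {W : Type*} {L : SComplex W} {lam : ℝ} (hlam : 0 < lam)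
    {c : Finset (Finset W)} (hc : L.IsChainOfFaces c)
    {E : Type*} [NormedAddCommGroup E] [NormedSpace ℝ E] : ExtE E (oS L lam c) := by
  obtain ⟨r, hr, hmin⟩ := chain_min hc
  have hrf := hc.2.1 r hr
  have hrc : 0 < (r.card : ℝ) := by
    exact_mod_cast Finset.card_pos.2 (L.nonempty_of_mem r hrf)
  have hall : ∀ w, (∀ q ∈ c, w ∈ q) ↔ w ∈ r := fun w => ⟨fun h => h r hr, fun h q hq => hmin q hq h⟩
  set b : L.space lam := ⟨bary lam r, bary_mem L hlam hrf⟩ with hb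
  have hbv : ∀ w, (b : lp (fun _ : W => ℝ) 1) w = if w ∈ r then lam / (r.card : ℝ) else 0 :=
    fun w => rfl
  have hmem : ∀ y ∈ oS L lam c, ∀ t ∈ Icc (0:ℝ) 1,
      (1 - t) • (y : lp (fun _ : W => ℝ) 1) + t • (b : lp (fun _ : W => ℝ) 1) ∈ L.space lam := by
    intro y hy t ht
    obtain ⟨s, hs, hsup⟩ := space_face hlam y.2
    refine conv_mem y.2 b.2 s hs (fun v => (hsup v).1) (fun w hw => (hsup w).1 ?_) t ht
    apply hy w
    rw [hall]
    by_contra h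
    rw [hbv, if_neg h] at hw
    exact hw rfl
  refine (ExtE.singleton (E := E) b).retract ?_ (fun q => toSpace b
    ((1 - q.2) • (q.1 : lp (fun _ : W => ℝ) 1) + q.2 • (b : lp (fun _ : W => ℝ) 1))) ?_ ?_ ?_ ?_
  · rintro y rfl w hw
    rw [hall] at hw
    rw [hbv, if_pos hw]
    positivity
  · apply toSpace_cont
    · have h4 : Continuous fun q : L.space lam × ℝ => (1 - q.2) • (q.1 : lp (fun _ : W => ℝ) 1) :=
        (continuous_const.sub continuous_snd).smul (continuous_subtype_val.comp continuous_fst)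
      have h5 : Continuous fun q : L.space lam × ℝ => q.2 • (b : lp (fun _ : W => ℝ) 1) :=
        continuous_snd.smul continuous_const
      exact (h4.add h5).continuousOn
    · intro q hq
      exact hmem q.1 hq.1 q.2 hq.2
  · intro y hy
    apply Subtype.ext
    have := hmem y hy 0 (by simp)
    rw [toSpace_val b this]
    simp
  · intro y hy
    apply Subtype.ext
    have := hmem y hy 1 (by simp)
    rw [toSpace_val b this]
    simp
  · intro y hy t ht w hw
    rw [toSpace_val b (hmem y hy t ht)]
    have e : ((1 - t) • (y : lp (fun _ : W => ℝ) 1) + t • (b : lp (fun _ : W => ℝ) 1) :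
      lp (fun _ : W => ℝ) 1) w =
      (1 - t) * (y : lp (fun _ : W => ℝ) 1) w + t * (b : lp (fun _ : W => ℝ) 1) w := rfl
    have hp : 0 < (y : lp (fun _ : W => ℝ) 1) w := lt_of_le_of_ne (y.2.1 w) (Ne.symm (hy w hw))
    rw [hall] at hw
    rw [e, hbv, if_pos hw]
    have hq : 0 < lam / (r.card : ℝ) := by positivity
    rcases lt_or_eq_of_le ht.2 with h1 | h1
    · have := mul_pos (sub_pos.2 h1) hp
      have := mul_nonneg ht.1 hq.le
      positivity
    · subst h1
      simp only [sub_self, zero_mul, zero_add, one_mul]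
      exact hq.ne'

theorem oO_mono {V W : Type*} {K : SComplex V} {κ : ℝ} {φ : V → Finset W}
    {c c' : Finset (Finset W)} (h : c' ⊆ c) : oO K κ φ c' ⊆ oO K κ φ c :=
  fun _ ⟨v, hv, hc⟩ => ⟨v, hv, h hc⟩

theorem oS_mono {W : Type*} {L : SComplex W} {lam : ℝ}
    {c c' : Finset (Finset W)} (h : c' ⊆ c) : oS L lam c' ⊆ oS L lam c :=
  fun _ hy w hw => hy w (fun r hr => hw r (h hr))

theorem glue_bd {m N : ℕ} (hN : 0 < N) {Y : Type*} [TopologicalSpace Y]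
    (a b : (Fin m → ℝ) → Y) (ha : ContinuousOn a (bigCube m N)) (hb : ContinuousOn b (bigCube m N))
    (hab : EqOn a b (bigBd m N)) :
    ContinuousOn (fun z : Fin (m+1) → ℝ => if z 0 ≤ (N:ℝ)/2 then a (fun i => z i.succ)
      else b (fun i => z i.succ)) (bigBd (m+1) N) := by
  have hN' : (0:ℝ) < N := by exact_mod_cast hN
  have ht : Continuous fun z : Fin (m+1) → ℝ => (fun i : Fin m => z i.succ) := by fun_prop
  have hm : ∀ z ∈ bigBd (m+1) N, (fun i : Fin m => z i.succ) ∈ bigCube m N :=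
    fun z hz i => hz.1 i.succ
  apply ContinuousOn.if
  · rintro z ⟨hz, hz'⟩
    have h2 : z 0 = (N:ℝ)/2 := frontier_le_subset_eq (continuous_apply 0) continuous_const hz'
    apply hab
    refine ⟨hm z hz, ?_⟩
    obtain ⟨i, hi⟩ := hz.2
    rcases Fin.eq_zero_or_eq_succ i with h | ⟨j, h⟩
    · subst h
      exfalso
      rcases hi with hi | hi <;> linarith
    · subst h
      exact ⟨j, hi⟩
  · exact (ha.comp ht.continuousOn hm).mono inter_subset_left
  · exact (hb.comp ht.continuousOn hm).mono inter_subset_left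

theorem lift_grid {m N : ℕ} (hN : 0 < N) {X Y A : Type*} [TopologicalSpace X] [TopologicalSpace Y]
    (p : C(X, Y)) (F : A → Prop) (U : A → Set Y) (Good : Finset A → Prop)
    (hGood : ∀ c : Finset A, c.Nonempty → ∀ y, (∀ a ∈ c, F a ∧ y ∈ U a) → Good c)
    (O : Finset A → Set X) (S : Finset A → Set Y)
    (hOm : ∀ c c', c' ⊆ c → O c' ⊆ O c) (hSm : ∀ c c', c' ⊆ c → S c' ⊆ S c)
    (hO : ∀ c, Good c → ∀ (ι : Type) [Fintype ι], Fintype.card ι ≤ m → ExtE (ι → ℝ) (O c))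
    (hS : ∀ c, Good c → ∀ (ι : Type) [Fintype ι], ExtE (ι → ℝ) (S c))
    (hpre : ∀ c, ∀ a ∈ c, F a → ∀ x, p x ∈ U a → x ∈ O c)
    (hmap : ∀ c, ∀ x ∈ O c, p x ∈ S c) (hUS : ∀ c, ∀ a ∈ c, U a ⊆ S c)
    (f : (Fin m → ℝ) → Y) (hf : Continuous f) (g : (Fin m → ℝ) → X)
    (hg : ContinuousOn g (bigBd m N)) (hfg : ∀ z ∈ bigBd m N, p (g z) = f z)
    (sg : (Fin m → ℤ) → A) (hsF : ∀ a : Fin m → ℤ, (∀ i, 0 ≤ a i ∧ a i ≤ N) → F (sg a))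
    (hsU : ∀ a : Fin m → ℤ, (∀ i, 0 ≤ a i ∧ a i ≤ N) → ∀ z : Fin m → ℝ,
      (∀ i, |z i - a i| ≤ 1) → f z ∈ U (sg a)) :
    ∃ G : (Fin m → ℝ) → X, ContinuousOn G (bigCube m N) ∧ EqOn G g (bigBd m N) ∧
      ∃ H : (Fin (m+1) → ℝ) → Y, ContinuousOn H (bigCube (m+1) N) ∧
        (∀ z ∈ bigCube (m+1) N, z 0 = 0 → H z = f (fun i => z i.succ)) ∧
        (∀ z ∈ bigCube (m+1) N, z 0 = N → H z = p (G (fun i => z i.succ))) ∧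
        (∀ z ∈ bigCube (m+1) N, (fun i => z i.succ) ∈ bigBd m N → H z = f (fun i => z i.succ)) := by
  have hN' : (0:ℝ) < N := by exact_mod_cast hN
  set c : (Fin m → ℤ) × (Fin m → ℤ) → Finset A := fun e => (Finset.Icc e.1 e.2).image sg with hc
  have hcm : ∀ e e' : (Fin m → ℤ) × (Fin m → ℤ), e.1 ≤ e'.1 → e'.2 ≤ e.2 → c e' ⊆ c e := by
    intro e e' h1 h2
    exact Finset.image_subset_image (Finset.Icc_subset_Icc h1 h2)
  have hc1 : ∀ e : (Fin m → ℤ) × (Fin m → ℤ), IsGCell N e → sg e.1 ∈ c e := by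
    intro e he
    exact Finset.mem_image_of_mem _ (Finset.left_mem_Icc.2 (fun i => (he i).2.1))
  have hgr : ∀ e : (Fin m → ℤ) × (Fin m → ℤ), IsGCell N e → ∀ i, 0 ≤ e.1 i ∧ e.1 i ≤ N := by
    intro e he i
    obtain ⟨h1, h2, h3, h4⟩ := he i
    exact ⟨h1, h2.trans h4⟩
  have hfU : ∀ e : (Fin m → ℤ) × (Fin m → ℤ), IsGCell N e → ∀ z ∈ gcell e, f z ∈ U (sg e.1) := by
    intro e he z hz
    apply hsU _ (hgr e he)
    intro i
    have h3 : (e.2 i : ℝ) ≤ e.1 i + 1 := by exact_mod_cast (he i).2.2.1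
    have := hz i
    rw [abs_le]; constructor <;> linarith [this.1, this.2]
  have hgood : ∀ e : (Fin m → ℤ) × (Fin m → ℤ), IsGCell N e → Good (c e) := by
    intro e he
    apply hGood _ ⟨_, hc1 e he⟩ (f (fun i => (e.1 i : ℝ)))
    intro a ha
    obtain ⟨b, hb, rfl⟩ := Finset.mem_image.1 ha
    rw [Finset.mem_Icc] at hb
    have hbN : ∀ i, 0 ≤ b i ∧ b i ≤ N := fun i =>
      ⟨(he i).1.trans (hb.1 i), (hb.2 i).trans (he i).2.2.2⟩
    refine ⟨hsF b hbN, hsU b hbN _ fun i => ?_⟩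
    have h1 : e.1 i ≤ b i := hb.1 i
    have h2 : b i ≤ e.1 i + 1 := (hb.2 i).trans (he i).2.2.1
    have h1' : (e.1 i : ℝ) ≤ b i := by exact_mod_cast h1
    have h2' : (b i : ℝ) ≤ e.1 i + 1 := by exact_mod_cast h2
    rw [abs_le]; constructor <;> linarith
  obtain ⟨G, cG, eG, mG⟩ := grid_extend (N := N) (fun e => O (c e))
    (fun e e' _ _ h1 h2 => hOm _ _ (hcm e e' h1 h2))
    (fun e he => hO _ (hgood e he) _ ((Fintype.card_subtype_le _).trans (by simp))) g hg
    (fun e he z hz hzb => hpre _ _ (hc1 e he) (hsF _ (hgr e he)) _ (by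
      rw [hfg z hzb]; exact hfU e he z hz))
  refine ⟨G, cG, eG, ?_⟩
  have hab : EqOn f (fun z => p (G z)) (bigBd m N) := fun z hz => by
    dsimp only; rw [eG hz, hfg z hz]
  have hFc := glue_bd hN f (fun z => p (G z)) hf.continuousOn
    (p.continuous.comp_continuousOn cG) hab
  set tl : (Fin (m+1) → ℤ) × (Fin (m+1) → ℤ) → (Fin m → ℤ) × (Fin m → ℤ) :=
    fun e => (fun i => e.1 i.succ, fun i => e.2 i.succ) with htl
  have htg : ∀ e, IsGCell N e → IsGCell N (tl e) := fun e he i => he i.succ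
  obtain ⟨H, cH, eH, -⟩ := grid_extend (N := N) (fun e => S (c (tl e)))
    (fun e e' _ _ h1 h2 => hSm _ _ (hcm _ _ (fun i => h1 i.succ) (fun i => h2 i.succ)))
    (fun e he => hS _ (hgood _ (htg e he)) _) _ hFc
    (fun e he z hz hzb => by
      have hz' : (fun i : Fin m => z i.succ) ∈ gcell (tl e) := fun i => hz i.succ
      split_ifs
      · exact hUS _ _ (hc1 _ (htg e he)) (hfU _ (htg e he) _ hz')
      · exact hmap _ _ (mG _ (htg e he) hz'))
  refine ⟨H, cH, ?_, ?_, ?_⟩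
  · intro z hz h0
    rw [eH ⟨hz, 0, Or.inl h0⟩]
    dsimp only
    rw [if_pos (by rw [h0]; positivity)]
  · intro z hz h0
    rw [eH ⟨hz, 0, Or.inr h0⟩]
    dsimp only
    rw [if_neg (by rw [h0]; linarith)]
  · intro z hz hb
    obtain ⟨i, hi⟩ := hb.2
    rw [eH ⟨hz, i.succ, hi⟩]
    dsimp only
    split_ifs
    · rfl
    · exact (hab hb).symm

theorem isCompact_bigCube (m N : ℕ) : IsCompact (bigCube m N) := by
  have : bigCube m N = Set.pi univ (fun _ => Icc (0:ℝ) N) := by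
    ext z; exact ⟨fun h i _ => h i, fun h i => h i trivial⟩
  rw [this]
  exact isCompact_univ_pi fun _ => isCompact_Icc

theorem lift_main {m : ℕ} {X Y A : Type*} [TopologicalSpace X] [TopologicalSpace Y]
    (p : C(X, Y)) (F : A → Prop) (U : A → Set Y) (Good : Finset A → Prop)
    (hUo : ∀ a, IsOpen (U a)) (hcov : ∀ y, ∃ a, F a ∧ y ∈ U a)
    (hGood : ∀ c : Finset A, c.Nonempty → ∀ y, (∀ a ∈ c, F a ∧ y ∈ U a) → Good c)
    (O : Finset A → Set X) (S : Finset A → Set Y)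
    (hOm : ∀ c c', c' ⊆ c → O c' ⊆ O c) (hSm : ∀ c c', c' ⊆ c → S c' ⊆ S c)
    (hO : ∀ c, Good c → ∀ (ι : Type) [Fintype ι], Fintype.card ι ≤ m → ExtE (ι → ℝ) (O c))
    (hS : ∀ c, Good c → ∀ (ι : Type) [Fintype ι], ExtE (ι → ℝ) (S c))
    (hpre : ∀ c, ∀ a ∈ c, F a → ∀ x, p x ∈ U a → x ∈ O c)
    (hmap : ∀ c, ∀ x ∈ O c, p x ∈ S c) (hUS : ∀ c, ∀ a ∈ c, U a ⊆ S c)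
    (f : (Fin m → ℝ) → Y) (hf : Continuous f) (g : (Fin m → ℝ) → X)
    (hg : ContinuousOn g (bigBd m 1)) (hfg : ∀ z ∈ bigBd m 1, p (g z) = f z) :
    ∃ G : (Fin m → ℝ) → X, ContinuousOn G (bigCube m 1) ∧ EqOn G g (bigBd m 1) ∧
      ∃ H : (Fin (m+1) → ℝ) → Y, ContinuousOn H (bigCube (m+1) 1) ∧
        (∀ z ∈ bigCube (m+1) 1, z 0 = 0 → H z = f (fun i => z i.succ)) ∧
        (∀ z ∈ bigCube (m+1) 1, z 0 = 1 → H z = p (G (fun i => z i.succ))) ∧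
        (∀ z ∈ bigCube (m+1) 1, (fun i => z i.succ) ∈ bigBd m 1 → H z = f (fun i => z i.succ)) := by
  obtain ⟨δ, hδ, hleb⟩ := lebesgue_number_lemma_of_metric (isCompact_bigCube m 1)
    (c := fun a : {a // F a} => f ⁻¹' (U a)) (fun a => (hUo a).preimage hf)
    (fun z _ => by
      obtain ⟨a, ha, hz⟩ := hcov (f z)
      exact mem_iUnion.2 ⟨⟨a, ha⟩, hz⟩)
  obtain ⟨N, hN⟩ := exists_nat_gt (1 / δ)
  have hN' : (0:ℝ) < N := lt_trans (by positivity) hN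
  have hN0 : 0 < N := by exact_mod_cast hN'
  have hNδ : 1 / (N:ℝ) < δ := by
    rw [div_lt_iff₀ hδ] at hN
    rw [div_lt_iff₀ hN']; linarith
  have hA : Nonempty A := ⟨(hcov (f 0)).choose⟩
  have hsc : ∀ a : Fin m → ℤ, ∃ s : A, (∀ i, 0 ≤ a i ∧ a i ≤ N) → F s ∧ ∀ z : Fin m → ℝ,
      (∀ i, |z i - a i| ≤ 1) → f ((1/(N:ℝ)) • z) ∈ U s := by
    intro a
    by_cases ha : ∀ i, 0 ≤ a i ∧ a i ≤ N
    · obtain ⟨s, hs⟩ := hleb (fun i => (1/(N:ℝ)) * (a i : ℝ)) (by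
        intro i
        have h1 : (0:ℝ) ≤ a i := by exact_mod_cast (ha i).1
        have h2 : (a i : ℝ) ≤ N := by exact_mod_cast (ha i).2
        refine ⟨by positivity, ?_⟩
        rw [one_div, inv_mul_le_iff₀ hN']; simpa using h2)
      refine ⟨s.1, fun _ => ⟨s.2, fun z hz => hs ?_⟩⟩
      rw [mem_ball, dist_pi_lt_iff hδ]
      intro i
      rw [Pi.smul_apply, smul_eq_mul, Real.dist_eq, ← mul_sub, abs_mul,
        abs_of_pos (by positivity : (0:ℝ) < 1/(N:ℝ))]
      calc 1/(N:ℝ) * |z i - a i| ≤ 1/(N:ℝ) * 1 := by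
            apply mul_le_mul_of_nonneg_left (hz i); positivity
        _ < δ := by rw [mul_one]; exact hNδ
    · exact ⟨Classical.arbitrary A, fun h => absurd h ha⟩
  choose sg hsg using hsc
  have hdn : ∀ k, ∀ z ∈ bigCube k N, (1/(N:ℝ)) • z ∈ bigCube k 1 := by
    intro k z hz i
    obtain ⟨h1, h2⟩ := hz i
    rw [Pi.smul_apply, smul_eq_mul]
    refine ⟨by positivity, ?_⟩
    rw [one_div, inv_mul_le_iff₀ hN']; simpa using h2
  have hdnb : ∀ k, ∀ z ∈ bigBd k N, (1/(N:ℝ)) • z ∈ bigBd k 1 := by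
    intro k z hz
    obtain ⟨i, hi⟩ := hz.2
    refine ⟨hdn k z hz.1, i, ?_⟩
    rw [Pi.smul_apply, smul_eq_mul]
    rcases hi with hi | hi
    · left; rw [hi]; simp
    · right; rw [hi]; field_simp; simp
  have hup : ∀ k, ∀ z ∈ bigCube k 1, (N:ℝ) • z ∈ bigCube k N := by
    intro k z hz i
    obtain ⟨h1, h2⟩ := hz i
    rw [Pi.smul_apply, smul_eq_mul]
    refine ⟨by positivity, ?_⟩
    rw [Nat.cast_one] at h2
    nlinarith
  have hupb : ∀ k, ∀ z ∈ bigBd k 1, (N:ℝ) • z ∈ bigBd k N := by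
    intro k z hz
    obtain ⟨i, hi⟩ := hz.2
    refine ⟨hup k z hz.1, i, ?_⟩
    rw [Pi.smul_apply, smul_eq_mul]
    rcases hi with hi | hi
    · left; rw [hi]; simp
    · right; rw [hi]; simp
  have hinv : ∀ k, ∀ z : Fin k → ℝ, (1/(N:ℝ)) • ((N:ℝ) • z) = z := by
    intro k z
    rw [smul_smul, one_div, inv_mul_cancel₀ hN'.ne', one_smul]
  obtain ⟨G, cG, eG, H, cH, H0, H1, Hb⟩ := lift_grid hN0 p F U Good hGood O S hOm hSm hO hS hpre
    hmap hUS (fun z => f ((1/(N:ℝ)) • z)) (hf.comp (continuous_const_smul _))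
    (fun z => g ((1/(N:ℝ)) • z))
    (hg.comp (continuous_const_smul _).continuousOn (hdnb m))
    (fun z hz => hfg _ (hdnb m z hz)) sg (fun a ha => (hsg a ha).1) (fun a ha => (hsg a ha).2)
  have htl : ∀ z : Fin (m+1) → ℝ, (fun i : Fin m => ((N:ℝ) • z) i.succ) =
    (N:ℝ) • (fun i : Fin m => z i.succ) := fun z => rfl
  refine ⟨fun z => G ((N:ℝ) • z), cG.comp (continuous_const_smul _).continuousOn (hup m), ?_,
    fun z => H ((N:ℝ) • z), cH.comp (continuous_const_smul _).continuousOn (hup (m+1)), ?_, ?_, ?_⟩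
  · intro z hz
    have := eG (hupb m z hz)
    dsimp only at this ⊢
    rw [this, hinv]
  · intro z hz h0
    dsimp only
    rw [H0 _ (hup _ z hz) (by simp [h0]), htl, hinv]
  · intro z hz h0
    dsimp only
    rw [H1 _ (hup _ z hz) (by simp [h0]), htl]
  · intro z hz hb
    dsimp only
    rw [Hb _ (hup _ z hz) (by rw [htl]; exact hupb m _ hb), htl, hinv]

def Lifts {X Y : Type*} [TopologicalSpace X] [TopologicalSpace Y] (p : C(X, Y)) (m : ℕ) : Prop :=
  ∀ (f : (Fin m → ℝ) → Y) (_ : Continuous f) (g : (Fin m → ℝ) → X)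
    (_ : ContinuousOn g (bigBd m 1)) (_ : ∀ z ∈ bigBd m 1, p (g z) = f z),
    ∃ G : (Fin m → ℝ) → X, ContinuousOn G (bigCube m 1) ∧ EqOn G g (bigBd m 1) ∧
      ∃ H : (Fin (m+1) → ℝ) → Y, ContinuousOn H (bigCube (m+1) 1) ∧
        (∀ z ∈ bigCube (m+1) 1, z 0 = 0 → H z = f (fun i => z i.succ)) ∧
        (∀ z ∈ bigCube (m+1) 1, z 0 = 1 → H z = p (G (fun i => z i.succ))) ∧
        (∀ z ∈ bigCube (m+1) 1, (fun i => z i.succ) ∈ bigBd m 1 → H z = f (fun i => z i.succ))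

noncomputable def prC {k : ℕ} (z : Fin k → ℝ) : Fin k → I := fun i => projIcc 0 1 zero_le_one (z i)

theorem prC_cont {k : ℕ} : Continuous (prC (k := k)) :=
  continuous_pi fun i => continuous_projIcc.comp (continuous_apply i)

theorem prC_coe {k : ℕ} (y : Fin k → I) : prC (fun i => (y i : ℝ)) = y := by
  funext i
  exact projIcc_val _ _

theorem prC_bd {k : ℕ} {z : Fin k → ℝ} (hz : z ∈ bigBd k 1) : prC z ∈ Cube.boundary (Fin k) := by
  obtain ⟨i, hi⟩ := hz.2
  refine ⟨i, ?_⟩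
  rcases hi with hi | hi
  · left; simp [prC, hi]
  · right; simp [prC, hi]

theorem coe_cube {k : ℕ} (y : Fin k → I) : (fun i => (y i : ℝ)) ∈ bigCube k 1 := fun i =>
  ⟨(y i).2.1, by rw [Nat.cast_one]; exact (y i).2.2⟩

theorem coe_bd {k : ℕ} {y : Fin k → I} (hy : y ∈ Cube.boundary (Fin k)) :
    (fun i => (y i : ℝ)) ∈ bigBd k 1 := by
  refine ⟨coe_cube y, ?_⟩
  obtain ⟨i, hi⟩ := hy
  refine ⟨i, ?_⟩
  rcases hi with hi | hi
  · left; simp [hi]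
  · right; simp [hi]

/-- the point of the (k+1)-cube -/
def csC {k : ℕ} (q : I × (Fin k → I)) : Fin (k+1) → ℝ :=
  fun i => ((Fin.cons q.1 q.2 : Fin (k+1) → I) i : ℝ)

theorem csC_cont {k : ℕ} : Continuous (csC (k := k)) := by
  apply continuous_pi
  intro i
  refine Fin.cases ?_ (fun j => ?_) i
  · exact continuous_subtype_val.comp continuous_fst
  · exact continuous_subtype_val.comp ((continuous_apply j).comp continuous_snd)

theorem csC_cube {k : ℕ} (q : I × (Fin k → I)) : csC q ∈ bigCube (k+1) 1 := coe_cube _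

theorem csC_zero {k : ℕ} (q : I × (Fin k → I)) : csC q 0 = q.1 := rfl

theorem csC_succ {k : ℕ} (q : I × (Fin k → I)) :
    (fun i : Fin k => csC q i.succ) = fun i => (q.2 i : ℝ) := rfl

theorem mk_eq {k : ℕ} {Y : Type*} [TopologicalSpace Y] {y : Y} (f0 f1 : GenLoop (Fin k) Y y)
    (H : I × (Fin k → I) → Y) (hc : Continuous H) (h0 : ∀ a, H (0, a) = f0 a)
    (h1 : ∀ a, H (1, a) = f1 a) (hb : ∀ t, ∀ a ∈ Cube.boundary (Fin k), H (t, a) = y) :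
    (Quotient.mk (GenLoop.Homotopic.setoid (Fin k) y) f0) =
      Quotient.mk (GenLoop.Homotopic.setoid (Fin k) y) f1 := by
  apply Quotient.sound
  exact ⟨{ toFun := H
           continuous_toFun := hc
           map_zero_left := h0
           map_one_left := h1
           prop' := fun t a ha => (hb t a ha).trans (f0.2 a ha).symm }⟩

theorem Lifts.surj {X Y : Type*} [TopologicalSpace X] [TopologicalSpace Y] {p : C(X, Y)} {k : ℕ}
    (h : Lifts p k) (x : X) : Function.Surjective (HomotopyGroup.inducedMap p (Fin k) x) := by
  intro q
  induction q using Quotient.inductionOn with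
  | h f =>
  obtain ⟨G, cG, eG, H, cH, H0, H1, Hb⟩ := h (fun z => f (prC z)) (f.1.continuous.comp prC_cont)
    (fun _ => x) continuousOn_const (fun z hz => (f.2 _ (prC_bd hz)).symm)
  have hcG : Continuous fun y : Fin k → I => G (fun i => (y i : ℝ)) :=
    cG.comp_continuous (by fun_prop) coe_cube
  let G' : GenLoop (Fin k) X x := ⟨⟨_, hcG⟩, fun y hy => eG (coe_bd hy)⟩
  refine ⟨Quotient.mk _ G', ?_⟩
  symm
  refine mk_eq f ⟨p.comp G'.1, _⟩ (fun q => H (csC q)) (cH.comp_continuous csC_cont csC_cube)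
    ?_ ?_ ?_
  · intro a
    rw [H0 _ (csC_cube _) rfl, csC_succ, prC_coe]
  · intro a
    rw [H1 _ (csC_cube _) rfl, csC_succ]
    rfl
  · intro t a ha
    rw [Hb _ (csC_cube _) (by rw [csC_succ]; exact coe_bd ha), csC_succ, prC_coe]
    exact f.2 a ha

theorem Lifts.inj {X Y : Type*} [TopologicalSpace X] [TopologicalSpace Y] {p : C(X, Y)} {k : ℕ}
    (h : Lifts p (k+1)) (x : X) : Function.Injective (HomotopyGroup.inducedMap p (Fin k) x) := by
  intro q0 q1
  induction q0 using Quotient.inductionOn with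
  | h g0 =>
  induction q1 using Quotient.inductionOn with
  | h g1 =>
  intro he
  obtain ⟨F⟩ := Quotient.exact he
  have F0 : ∀ a, F (0, a) = p (g0 a) := fun a => F.apply_zero a
  have F1 : ∀ a, F (1, a) = p (g1 a) := fun a => F.apply_one a
  have Fb : ∀ t, ∀ a ∈ Cube.boundary (Fin k), F (t, a) = p x := fun t a ha => by
    have h1 : F (t, a) = p (g0 a) := F.prop t a ha
    exact h1.trans (congrArg p (g0.2 a ha))
  have hgl := glue_bd (m := k) one_pos (fun z => g0 (prC z)) (fun z => g1 (prC z))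
    (g0.1.continuous.comp prC_cont).continuousOn (g1.1.continuous.comp prC_cont).continuousOn
    (fun z hz => (g0.2 _ (prC_bd hz)).trans (g1.2 _ (prC_bd hz)).symm)
  rw [Nat.cast_one] at hgl
  obtain ⟨G, cG, eG, -⟩ := h (fun z => F (projIcc 0 1 zero_le_one (z 0), prC (fun i => z i.succ)))
    (F.continuous.comp ((continuous_projIcc.comp (continuous_apply 0)).prodMk
      (prC_cont.comp (by fun_prop)))) _ hgl (by
    intro z hz
    obtain ⟨i, hi⟩ := hz.2
    have hcase : z 0 = 0 ∨ z 0 = 1 ∨ (fun i : Fin k => z i.succ) ∈ bigBd k 1 := by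
      rcases Fin.eq_zero_or_eq_succ i with h | ⟨j, h⟩
      · subst h
        rcases hi with hi | hi
        · exact Or.inl hi
        · right; left; simpa using hi
      · subst h
        exact Or.inr (Or.inr ⟨fun i => hz.1 i.succ, j, hi⟩)
    rcases hcase with h0 | h0 | h0
    · rw [if_pos (by rw [h0]; norm_num), h0, projIcc_left]
      exact (F0 _).symm
    · rw [if_neg (by rw [h0]; norm_num), h0, projIcc_right]
      exact (F1 _).symm
    · have hb := prC_bd h0
      rw [Fb _ _ hb]
      split_ifs
      · exact congrArg p (g0.2 _ hb)
      · exact congrArg p (g1.2 _ hb))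
  refine mk_eq g0 g1 (fun q => G (csC q)) (cG.comp_continuous csC_cont csC_cube) ?_ ?_ ?_
  · intro a
    rw [eG ⟨csC_cube _, 0, Or.inl rfl⟩]
    dsimp only
    rw [csC_zero, if_pos (by norm_num), csC_succ, prC_coe]
  · intro a
    rw [eG ⟨csC_cube _, 0, Or.inr (by simp [csC_zero])⟩]
    dsimp only
    rw [csC_zero, if_neg (by norm_num), csC_succ, prC_coe]
  · intro t a ha
    obtain ⟨i, hi⟩ := (coe_bd ha).2
    have hi' : csC (t, a) i.succ = 0 ∨ csC (t, a) i.succ = ((1:ℕ):ℝ) := hi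
    rw [eG ⟨csC_cube _, i.succ, hi'⟩]
    dsimp only
    rw [csC_succ, prC_coe]
    split_ifs
    · exact g0.2 a ha
    · exact g1.2 a ha

theorem lifts_of_regular {V W : Type*} (n : ℕ) (K : SComplex V) (L : SComplex W)
    (κ lam : ℝ) (hκ : 0 < κ) (hlam : 0 < lam)
    (p : C((K.space κ), (L.space lam)))
    (hsurj : Function.Surjective p)
    (hreg : SComplex.IsNRegularMap n K L κ lam p) (m : ℕ) (hm : m ≤ n) : Lifts p m := by
  obtain ⟨⟨φ, hq⟩, hv⟩ := hreg
  have hQ : QS K L κ lam p φ := hq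
  intro f hf g hg hfg
  exact lift_main p (fun r => r ∈ L.faces) (fun r => oU L lam r) (fun c => L.IsChainOfFaces c)
    (isOpen_oU L lam) (oU_cover L hlam)
    (fun c hc y hy => ⟨hc, fun r hr => (hy r hr).1, fun r hr q hq =>
      oU_chain L (hy r hr).2 (hy q hq).2⟩)
    (fun c => oO K κ φ c) (fun c => oS L lam c) (fun c c' h => oO_mono h) (fun c c' h => oS_mono h)
    (fun c hc ι _ hι => hQ.ext_oO hκ hlam hc (by
      apply extE_of_vanishing (n := n) _ (hv c hc) ι (hι.trans hm)
      obtain ⟨r, hr⟩ := hc.1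
      obtain ⟨x, hx⟩ := hsurj ⟨bary lam r, bary_mem L hlam (hc.2.1 r hr)⟩
      refine ⟨x, ?_⟩
      rw [mem_preimage, hx]
      exact bary_chainCell L hlam (hc.2.1 r hr) hr))
    (fun c hc ι _ => ext_oS hlam hc)
    (fun c a ha hF x hx => hQ.preimage_oU hκ hlam (L.nonempty_of_mem a hF) hx ha)
    (fun c x hx => hQ.map_oO hκ hlam hx)
    (fun c a ha => oU_sub_oS ha) f hf g hg hfg

/-- A surjective, `n`-regular quasi-simplicial map between polyhedra is
a weak `n`-homotopy equivalence. -/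
theorem statement2 {V W : Type*} (n : ℕ) (K : SComplex V) (L : SComplex W)
    (κ lam : ℝ) (hκ : 0 < κ) (hlam : 0 < lam)
    (p : C((K.space κ), (L.space lam)))
    (hsurj : Function.Surjective p)
    (hreg : SComplex.IsNRegularMap n K L κ lam p) :
    IsWeakNHomotopyEquiv n p := by
  intro k hk x
  exact ⟨(lifts_of_regular n K L κ lam hκ hlam p hsurj hreg (k+1) hk).inj x,
    (lifts_of_regular n K L κ lam hκ hlam p hsurj hreg k hk.le).surj x⟩
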